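/- arXiv:2102.10509 — 2 statements merged into one kernel-verified Lean document; each statement's English description precedes it below -/
import Mathlib

section
/- For every integer k ≥ 2 and every n there exists a bound F(n,k) ∈ ℕ such that the following holds for every finite field 𝔽 with |𝔽| > F(n,k). For every k-tensor T ∈ 𝔽^{n_1 × ⋯ × n_k} with n_1,…,n_k ≤ n, the partition rank of T over 𝔽 satisfies PR(T) ≤ (2^{k−1} − 1)·AR(T) + 1, where AR(T) is the analytic rank of T over 𝔽. Equivalently, writing q = |𝔽|, N = n_1 + ⋯ + n_{k−1}, and K = {x ∈ 𝔽^{n_1} × ⋯ × 𝔽^{n_{k−1}} : T(x, y) = 0 for all y ∈ 𝔽^{n_k}}, the conclusion reads (PR(T) : ℝ) ≤ (2^{k−1} − 1)·(N − log_q |K|) + 1. -/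
/-- `p`, a function of a multi-index, depends only on the coordinates in `S`. -/
def DependsOnlyOn {ι : Type*} {β : ι → Type*} {α : Type*}
    (p : ((i : ι) → β i) → α) (S : Set ι) : Prop :=
  ∀ x y : (i : ι) → β i, (∀ i ∈ S, x i = y i) → p x = p y

/-- `T` admits a partition-rank decomposition with `r` summands: `T = ∑_{j<r} p_j * q_j`
where `p_j` is a tensor in the variable blocks indexed by the nonempty proper subset `S j`
and `q_j` is a tensor in the complementary blocks. -/
def HasPRDecomp {ι : Type*} {β : ι → Type*} {F : Type*} [CommRing F]
    (T : ((i : ι) → β i) → F) (r : ℕ) : Prop :=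
  ∃ (S : Fin r → Set ι) (p q : Fin r → ((i : ι) → β i) → F),
    (∀ j, (S j).Nonempty ∧ S j ≠ Set.univ ∧
      DependsOnlyOn (p j) (S j) ∧ DependsOnlyOn (q j) (S j)ᶜ) ∧
    ∀ I, T I = ∑ j, p j I * q j I

/-- The partition rank of a tensor `T`. -/
noncomputable def partitionRank {ι : Type*} {β : ι → Type*} {F : Type*} [CommRing F]
    (T : ((i : ι) → β i) → F) : ℕ :=
  sInf {r | HasPRDecomp T r}

/-- Evaluation of the multilinear form associated with the array `T` at the tuple of
vectors `x`. -/
def mlEval {k : ℕ} {d : Fin k → ℕ} {F : Type*} [CommRing F]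
    (T : ((i : Fin k) → Fin (d i)) → F) (x : (i : Fin k) → Fin (d i) → F) : F :=
  ∑ I : (i : Fin k) → Fin (d i), T I * ∏ i, x i (I i)
section Aux
open MvPolynomial

theorem aux_totalDegree_pderiv {σ F : Type*} [Fintype σ] [Field F] (c : σ) (g : MvPolynomial σ F) :
    (pderiv c g).totalDegree ≤ g.totalDegree := by
  classical
  conv_lhs => rw [g.as_sum, map_sum]
  apply totalDegree_finsetSum_le
  intro s hs
  rw [pderiv_monomial]
  refine (totalDegree_monomial_le _ _).trans ?_
  refine le_trans ?_ (le_totalDegree hs)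
  rw [Finsupp.sum_fintype _ _ (by simp), Finsupp.sum_fintype _ _ (by simp)]
  refine Finset.sum_le_sum fun i _ => ?_
  simp

theorem aux_totalDegree_det {σ F : Type*} [Field F] {r d : ℕ}
    (M : Matrix (Fin r) (Fin r) (MvPolynomial σ F)) (h : ∀ i j, (M i j).totalDegree ≤ d) :
    M.det.totalDegree ≤ r * d := by
  classical
  rw [Matrix.det_apply]
  apply totalDegree_finsetSum_le
  intro e _
  have h1 : (∏ i, M (e i) i).totalDegree ≤ r * d := by
    refine (totalDegree_finsetProd _ _).trans ?_
    refine (Finset.sum_le_sum (fun i _ => h (e i) i)).trans ?_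
    simp
  rcases Int.units_eq_one_or (Equiv.Perm.sign e) with h2 | h2 <;> rw [h2]
  · simpa using h1
  · simpa using h1

theorem aux_finrank {σ F : Type*} [Fintype σ] [Field F] (D : ℕ) :
    Module.Finite F (restrictTotalDegree σ F D) ∧
    Module.finrank F (restrictTotalDegree σ F D) ≤ (D + 1) ^ Fintype.card σ := by
  classical
  let S : Set (σ →₀ ℕ) := {n | (n.sum fun _ e => e) ≤ D}
  have hle : ∀ n : S, ∀ c, n.1 c < D + 1 := by
    intro n c
    have h1 : n.1.sum (fun _ e => e) ≤ D := n.2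
    rw [Finsupp.sum_fintype _ _ (by simp)] at h1
    have := Finset.single_le_sum (f := fun i => n.1 i) (fun _ _ => Nat.zero_le _)
      (Finset.mem_univ c)
    omega
  let emb : S → (σ → Fin (D + 1)) := fun n c => ⟨n.1 c, hle n c⟩
  have hinj : Function.Injective emb := by
    intro a b hab
    apply Subtype.ext
    ext c
    have := congrFun hab c
    simpa [emb] using this
  have hfin : Finite S := Finite.of_injective emb hinj
  have : Fintype S := Fintype.ofFinite S
  let B := basisRestrictSupport F S
  have hB : Module.Finite F (restrictSupport F S) := Module.Finite.of_basis B
  refine ⟨hB, ?_⟩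
  have h2 : Module.finrank F (restrictSupport F S) = Fintype.card S :=
    Module.finrank_eq_card_basis B
  have h3 : Fintype.card S ≤ (D + 1) ^ Fintype.card σ := by
    have := Fintype.card_le_of_injective emb hinj
    simpa using this
  calc Module.finrank F (restrictTotalDegree σ F D)
      = Module.finrank F (restrictSupport F S) := rfl
    _ ≤ _ := by rw [h2]; exact h3

/-- Passing to a generic subset of `K`. -/
theorem aux_generic {σ F : Type*} [Fintype σ] [Field F] [DecidableEq F]
    (D : ℕ) (K : Finset (σ → F)) (hK : K.Nonempty) :
    ∃ Z ⊆ K, Z.Nonempty ∧ K.card ≤ 2 ^ ((D + 1) ^ Fintype.card σ) * Z.card ∧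
      ∀ g : MvPolynomial σ F, g.totalDegree ≤ D → (∃ x ∈ Z, eval x g ≠ 0) →
        Z.card ≤ 2 * (Z.filter (fun x => eval x g ≠ 0)).card := by
  classical
  obtain ⟨hfin, hrank⟩ := aux_finrank (σ := σ) (F := F) D
  let Van : Finset (σ → F) → Submodule F (restrictTotalDegree σ F D) := fun Z =>
    { carrier := {g | ∀ x ∈ Z, eval x g.1 = 0}
      add_mem' := by
        intro a b ha hb x hx
        simp [ha x hx, hb x hx]
      zero_mem' := by intro x hx; simp
      smul_mem' := by
        intro c a ha x hx
        simp [ha x hx, MvPolynomial.smul_eval] }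
  let w : Finset (σ → F) → ℕ := fun Z => Z.card * 2 ^ Module.finrank F (Van Z)
  obtain ⟨Z, hZ, hmax⟩ := Finset.exists_max_image (K.powerset.filter (·.Nonempty)) w
    ⟨K, by simp [hK]⟩
  simp only [Finset.mem_filter, Finset.mem_powerset] at hZ hmax
  refine ⟨Z, hZ.1, hZ.2, ?_, ?_⟩
  · have h1 := hmax K ⟨Finset.Subset.refl _, hK⟩
    have h2 : Module.finrank F (Van Z) ≤ (D + 1) ^ Fintype.card σ :=
      (Submodule.finrank_le _).trans hrank
    have hw0 : K.card ≤ w K := by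
      have : 0 < 2 ^ Module.finrank F (Van K) := by positivity
      exact Nat.le_mul_of_pos_right _ this
    calc K.card ≤ w K := hw0
      _ ≤ w Z := h1
      _ = 2 ^ Module.finrank F (Van Z) * Z.card := mul_comm _ _
      _ ≤ _ := Nat.mul_le_mul_right _ (Nat.pow_le_pow_right (by norm_num) h2)
  · rintro g hg ⟨x, hx, hgx⟩
    by_contra hcon
    push Not at hcon
    let Z' := Z.filter (fun x => eval x g = 0)
    have hcard : Z'.card + (Z.filter (fun x => eval x g ≠ 0)).card = Z.card :=
      Finset.card_filter_add_card_filter_not _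
    have hpos : 0 < Z'.card := by omega
    have hlt : Van Z < Van Z' := by
      refine lt_of_le_of_ne ?_ ?_
      · intro a ha y hy
        exact ha y (Finset.mem_filter.1 hy).1
      · intro heq
        have : (⟨g, (mem_restrictTotalDegree _ _ _).2 hg⟩ : restrictTotalDegree σ F D) ∈ Van Z' :=
          fun y hy => (Finset.mem_filter.1 hy).2
        rw [← heq] at this
        exact hgx (this x hx)
    have hr := Submodule.finrank_lt_finrank_of_lt hlt
    have h1 := hmax Z' ⟨(Finset.filter_subset _ _).trans hZ.1, Finset.card_pos.1 hpos⟩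
    have h2 : Z'.card * 2 ^ (Module.finrank F (Van Z) + 1) ≤ w Z' :=
      Nat.mul_le_mul_left _ (Nat.pow_le_pow_right (by norm_num) hr)
    have h3 : Z.card * 2 ^ Module.finrank F (Van Z) <
        Z'.card * 2 ^ (Module.finrank F (Van Z) + 1) := by
      rw [pow_succ, mul_comm (2 ^ _) 2, ← mul_assoc]
      exact Nat.mul_lt_mul_of_pos_right (by omega) (by positivity)
    exact absurd (h2.trans h1) (not_le.2 h3)

/-- First order Taylor expansion. -/
theorem aux_taylor {σ F A : Type*} [Fintype σ] [Field F] [CommRing A] [Algebra F A]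
    (x : σ → F) (u : σ → A) (g : MvPolynomial σ F) :
    ∃ w : Polynomial A,
      aeval (fun c => Polynomial.C (algebraMap F A (x c)) + Polynomial.X * Polynomial.C (u c)) g =
        Polynomial.C (algebraMap F A (eval x g)) +
        Polynomial.X * Polynomial.C (∑ c, algebraMap F A (eval x (pderiv c g)) * u c) +
        Polynomial.X ^ 2 * w := by
  classical
  induction g using MvPolynomial.induction_on with
  | C a => exact ⟨0, by simp [Polynomial.algebraMap_apply]⟩
  | add p q hp hq =>
    obtain ⟨w1, h1⟩ := hp
    obtain ⟨w2, h2⟩ := hq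
    refine ⟨w1 + w2, ?_⟩
    rw [map_add, h1, h2]
    simp only [map_add, add_mul, Finset.sum_add_distrib]
    ring
  | mul_X p i hp =>
    obtain ⟨w1, h1⟩ := hp
    set a := ∑ c, algebraMap F A (eval x (pderiv c p)) * u c with ha
    have hs : ∑ c, algebraMap F A (eval x (pderiv c (p * X i))) * u c =
        a * algebraMap F A (x i) + algebraMap F A (eval x p) * u i := by
      simp only [Derivation.leibniz, pderiv_X, smul_eq_mul, map_add, map_mul, eval_X, add_mul,
        Finset.sum_add_distrib]
      rw [ha, Finset.sum_mul, add_comm]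
      congr 1
      · exact Finset.sum_congr rfl fun c _ => by ring
      · rw [Finset.sum_eq_single i]
        · simp
        · intro c _ hc
          simp [Ne.symm hc]
        · simp
    refine ⟨Polynomial.C a * Polynomial.C (u i) + w1 * (Polynomial.C (algebraMap F A (x i)) +
      Polynomial.X * Polynomial.C (u i)), ?_⟩
    rw [hs, map_mul, h1]
    simp only [aeval_X, map_mul, eval_X, Polynomial.C_add]
    ring

/-- Linear independence of the products `e_y * h^α` near nonsingular zeros. -/
theorem aux_indep {σ F : Type*} [Fintype σ] [DecidableEq σ] [Field F]
    (P : Finset (σ → F)) (h : σ → MvPolynomial σ F)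
    (h0 : ∀ x ∈ P, ∀ c, eval x (h c) = 0)
    (hJ : ∀ x ∈ P, IsUnit (Matrix.of (fun c c' => eval x (pderiv c' (h c)))))
    (e : (σ → F) → MvPolynomial σ F)
    (e1 : ∀ x, eval x (e x) = 1) (e0 : ∀ x y, x ≠ y → eval x (e y) = 0)
    (m : σ → ℕ) :
    LinearIndependent F (fun ya : P × ((c : σ) → Fin (m c)) =>
      e ya.1.1 * ∏ c, h c ^ (ya.2 c : ℕ)) := by
  classical
  rw [Fintype.linearIndependent_iff]
  intro g hg
  by_contra hcon
  push Not at hcon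
  obtain ⟨i0, hi0⟩ := hcon
  let deg : P × ((c : σ) → Fin (m c)) → ℕ := fun ya => ∑ c, (ya.2 c : ℕ)
  obtain ⟨⟨⟨x, hx⟩, α⟩, hmem, hmin⟩ := Finset.exists_min_image
    (Finset.univ.filter (fun i => g i ≠ 0)) deg ⟨i0, by simp [hi0]⟩
  simp only [Finset.mem_filter, Finset.mem_univ, true_and] at hmem hmin
  set M := deg (⟨x, hx⟩, α) with hM
  -- the inverse Jacobian
  obtain ⟨G, hG⟩ := (hJ x hx).exists_right_inv
  let u : σ → (MvPolynomial σ F) := fun c => ∑ c', C (G c c') * X c'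
  let Ψ : MvPolynomial σ F →ₐ[F] Polynomial (MvPolynomial σ F) :=
    aeval (fun c => Polynomial.C (algebraMap F (MvPolynomial σ F) (x c)) + Polynomial.X * Polynomial.C (u c))
  have hu : ∀ c, ∑ c', algebraMap F (MvPolynomial σ F) (eval x (pderiv c' (h c))) * u c' = X c := by
    intro c
    have h1 : ∀ c'', ∑ c', eval x (pderiv c' (h c)) * G c' c'' = if c = c'' then 1 else 0 := by
      intro c''
      have := congrFun (congrFun hG c) c''
      simpa [Matrix.mul_apply, Matrix.one_apply] using this
    simp only [u, Finset.mul_sum]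
    rw [Finset.sum_comm]
    have h2 : ∀ c'', ∑ c', algebraMap F (MvPolynomial σ F) (eval x (pderiv c' (h c))) * (C (G c' c'') * X c'')
        = C (if c = c'' then 1 else 0) * (X c'' : (MvPolynomial σ F)) := by
      intro c''
      rw [← h1 c'', map_sum, Finset.sum_mul]
      refine Finset.sum_congr rfl fun c' _ => ?_
      rw [map_mul, mul_assoc]
      rfl
    rw [Finset.sum_congr rfl fun c'' _ => h2 c'']
    rw [Finset.sum_eq_single c]
    · simp
    · intro b _ hb
      simp [Ne.symm hb]
    · simp
  have hh : ∀ c, ∃ w : Polynomial (MvPolynomial σ F), Ψ (h c) = Polynomial.X * (Polynomial.C (X c) +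
      Polynomial.X * w) := by
    intro c
    obtain ⟨w, hw⟩ := aux_taylor x u (h c)
    refine ⟨w, ?_⟩
    change aeval _ (h c) = _
    rw [hw, hu, h0 x hx c]
    simp only [map_zero]
    ring
  choose w hw using hh
  have hcoef : ∀ i : P × ((c : σ) → Fin (m c)),
      Polynomial.coeff (Ψ (g i • (e i.1.1 * ∏ c, h c ^ (i.2 c : ℕ)))) M =
      if i.1.1 = x ∧ deg i = M then C (g i) * ∏ c, (X c : (MvPolynomial σ F)) ^ (i.2 c : ℕ) else 0 := by
    intro i
    by_cases hgi : g i = 0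
    · simp [hgi]
    have hdeg : M ≤ deg i := hmin i hgi
    have hexp : Ψ (g i • (e i.1.1 * ∏ c, h c ^ (i.2 c : ℕ))) =
        (Polynomial.C (C (g i)) * Ψ (e i.1.1) *
          ∏ c, (Polynomial.C (X c) + Polynomial.X * w c) ^ (i.2 c : ℕ)) *
          Polynomial.X ^ (deg i) := by
      rw [map_smul, map_mul, map_prod]
      simp only [map_pow, hw, mul_pow]
      rw [Finset.prod_mul_distrib, Finset.prod_pow_eq_pow_sum, Algebra.smul_def]
      change Polynomial.C (C (g i)) * _ = _
      ring
    rw [hexp]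
    by_cases hd : deg i = M
    · rw [hd]
      rw [Polynomial.coeff_mul_X_pow', if_pos le_rfl, Nat.sub_self]
      rw [Polynomial.coeff_zero_eq_eval_zero]
      simp only [Polynomial.eval_mul, Polynomial.eval_prod, Polynomial.eval_pow,
        Polynomial.eval_add, Polynomial.eval_C, Polynomial.eval_X, zero_mul, add_zero]
      obtain ⟨w', hw'⟩ := aux_taylor x u (e i.1.1)
      have he : Polynomial.eval 0 (Ψ (e i.1.1)) = algebraMap F (MvPolynomial σ F) (eval x (e i.1.1)) := by
        change Polynomial.eval 0 (aeval _ (e i.1.1)) = _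
        rw [hw']
        simp
      rw [he]
      by_cases hix : i.1.1 = x
      · simp [hix, e1]
      · simp [hix, e0 x i.1.1 (Ne.symm hix)]
    · have hlt : M < deg i := lt_of_le_of_ne hdeg (Ne.symm hd)
      rw [Polynomial.coeff_mul_X_pow']
      simp [hd, not_le.2 hlt]
  have h1 := congrArg (fun p => Polynomial.coeff (Ψ p) M) hg
  simp only [map_sum, map_zero, Polynomial.finsetSum_coeff, Polynomial.coeff_zero] at h1
  rw [Finset.sum_congr rfl fun i _ => hcoef i] at h1
  let a : σ →₀ ℕ := Finsupp.equivFunOnFinite.symm (fun c => (α c : ℕ))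
  have h2 := congrArg (MvPolynomial.coeff a) h1
  rw [MvPolynomial.coeff_sum, MvPolynomial.coeff_zero] at h2
  rw [Finset.sum_eq_single (⟨x, hx⟩, α)] at h2
  · rw [if_pos ⟨rfl, rfl⟩] at h2
    have hmon : (∏ c, (X c : (MvPolynomial σ F)) ^ ((α c : ℕ))) = monomial a 1 := by
      rw [monomial_eq, Finsupp.prod_fintype _ _ (by simp)]
      simp [a]
    rw [hmon, coeff_C_mul, coeff_monomial, if_pos rfl, mul_one] at h2
    exact hmem h2
  · rintro ⟨⟨y, hy⟩, β⟩ _ hne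
    split_ifs with hc
    · have hmon : (∏ c, (X c : (MvPolynomial σ F)) ^ ((β c : ℕ))) =
          monomial (Finsupp.equivFunOnFinite.symm (fun c => (β c : ℕ))) 1 := by
        rw [monomial_eq, Finsupp.prod_fintype _ _ (by simp)]
        simp
      rw [hmon, coeff_C_mul, coeff_monomial, if_neg, mul_zero]
      intro heq
      apply hne
      obtain ⟨hyx, _⟩ := hc
      simp only at hyx
      subst hyx
      congr 1
      funext c
      apply Fin.ext
      have := DFunLike.congr_fun heq c
      simpa [a] using this
    · simp
  · simp

/-- A weak Bezout bound for the number of nonsingular rational zeros. -/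
theorem aux_bezout {σ F : Type*} [Fintype σ] [DecidableEq σ] [Field F] [Fintype F]
    {r d : ℕ} (hd : 1 ≤ d) (f : Fin r → MvPolynomial σ F) (b : Fin r → σ)
    (hf : ∀ i, (f i).totalDegree ≤ d) (P : Finset (σ → F))
    (h0 : ∀ x ∈ P, ∀ i, eval x (f i) = 0)
    (hJ : ∀ x ∈ P, eval x (Matrix.det (Matrix.of fun i j => pderiv (b j) (f i))) ≠ 0) :
    P.card * Fintype.card F ^ r ≤
      (Fintype.card σ * d + 1) ^ Fintype.card σ * Fintype.card F ^ Fintype.card σ := by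
  classical
  rcases P.eq_empty_or_nonempty with rfl | ⟨x0, hx0⟩
  · simp
  have hJ' : ∀ x ∈ P, (Matrix.of fun i j => eval x (pderiv (b j) (f i))).det ≠ 0 := by
    intro x hx
    have := hJ x hx
    rw [RingHom.map_det] at this
    exact this
  have hb : Function.Injective b := by
    intro i j hij
    by_contra hne
    apply hJ' x0 hx0
    apply Matrix.det_zero_of_column_eq hne
    intro l
    simp [hij]
  set q := Fintype.card F with hq
  have hq1 : 1 ≤ q := Fintype.card_pos
  let h : σ → MvPolynomial σ F := fun c =>
    if hc : ∃ j, b j = c then f hc.choose else X c ^ q - X c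
  have hhb : ∀ j, h (b j) = f j := by
    intro j
    have hc : ∃ j', b j' = b j := ⟨j, rfl⟩
    simp only [h, dif_pos hc]
    rw [hb hc.choose_spec]
  have hhn : ∀ c, (¬ ∃ j, b j = c) → h c = X c ^ q - X c := by
    intro c hc
    simp only [h, dif_neg hc]
  have hh0 : ∀ x ∈ P, ∀ c, eval x (h c) = 0 := by
    intro x hx c
    by_cases hc : ∃ j, b j = c
    · obtain ⟨j, rfl⟩ := hc
      rw [hhb]
      exact h0 x hx j
    · rw [hhn c hc]
      simp [hq, FiniteField.pow_card]
  have hhJ : ∀ x ∈ P, IsUnit (Matrix.of (fun c c' => eval x (pderiv c' (h c)))) := by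
    intro x hx
    rw [← Matrix.mulVec_injective_iff_isUnit]
    rw [← Matrix.coe_mulVecLin, injective_iff_map_eq_zero]
    intro v hv
    rw [Matrix.mulVecLin_apply] at hv
    have hrow : ∀ c, ∑ c', eval x (pderiv c' (h c)) * v c' = 0 := by
      intro c
      have := congrFun hv c
      simpa [Matrix.mulVec, dotProduct] using this
    have hvn : ∀ c, (¬ ∃ j, b j = c) → v c = 0 := by
      intro c hc
      have := hrow c
      rw [hhn c hc] at this
      rw [Finset.sum_eq_single c] at this
      · simpa [Derivation.leibniz_pow, hq] using this
      · intro c' _ hne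
        simp [Derivation.leibniz_pow, pderiv_X, Ne.symm hne]
      · simp
    have hvb : (fun j => v (b j)) = 0 := by
      apply Matrix.eq_zero_of_mulVec_eq_zero (hJ' x hx)
      funext i
      have h1 := hrow (b i)
      rw [hhb] at h1
      simp only [Matrix.mulVec, dotProduct, Matrix.of_apply, Pi.zero_apply]
      rw [← h1]
      rw [← Finset.sum_image (s := Finset.univ) (g := b)
        (f := fun c => eval x (pderiv c (f i)) * v c) (fun _ _ _ _ h => hb h)]
      apply Finset.sum_subset (Finset.subset_univ _)
      intro c _ hc
      rw [hvn c (by simpa using hc), mul_zero]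
    funext c
    by_cases hc : ∃ j, b j = c
    · obtain ⟨j, rfl⟩ := hc
      exact congrFun hvb j
    · exact hvn c hc
  let e : (σ → F) → MvPolynomial σ F := fun y => indicator y
  let E : ℕ := P.sup (fun y => (e y).totalDegree)
  let M := E + 1
  let m : σ → ℕ := fun c => if ∃ j, b j = c then M * q else M
  have hind := aux_indep P h hh0 hhJ e (fun x => eval_indicator_apply_eq_one x)
    (fun x y hxy => eval_indicator_apply_eq_zero x y hxy) m
  let R := E + Fintype.card σ * (M * q * d)
  have hdeg : ∀ ya : P × ((c : σ) → Fin (m c)),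
      e ya.1.1 * ∏ c, h c ^ (ya.2 c : ℕ) ∈ restrictTotalDegree σ F R := by
    rintro ⟨⟨y, hy⟩, α⟩
    rw [mem_restrictTotalDegree]
    refine (totalDegree_mul _ _).trans ?_
    refine add_le_add (Finset.le_sup (f := fun y => (e y).totalDegree) hy) ?_
    refine (totalDegree_finsetProd _ _).trans ?_
    have : ∀ c ∈ Finset.univ, (h c ^ (α c : ℕ)).totalDegree ≤ M * q * d := by
      intro c _
      refine (totalDegree_pow _ _).trans ?_
      by_cases hc : ∃ j, b j = c
      · have h1 : (α c : ℕ) ≤ M * q := by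
          have := (α c).2
          simp only [m, if_pos hc] at this
          omega
        obtain ⟨j, rfl⟩ := hc
        rw [hhb]
        exact Nat.mul_le_mul h1 (hf j)
      · have h1 : (α c : ℕ) ≤ M := by
          have := (α c).2
          simp only [m, if_neg hc] at this
          omega
        have h2 : (h c).totalDegree ≤ q := by
          rw [hhn c hc]
          refine (totalDegree_sub _ _).trans ?_
          rw [totalDegree_X_pow, totalDegree_X]
          simp [hq1]
        calc _ ≤ M * q := Nat.mul_le_mul h1 h2
          _ ≤ M * q * d := Nat.le_mul_of_pos_right _ hd
    refine (Finset.sum_le_sum this).trans ?_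
    simp
  obtain ⟨hfin, hrank⟩ := aux_finrank (σ := σ) (F := F) R
  have hind' : LinearIndependent F (fun ya : P × ((c : σ) → Fin (m c)) =>
      (⟨_, hdeg ya⟩ : restrictTotalDegree σ F R)) := by
    apply LinearIndependent.of_comp (restrictTotalDegree σ F R).subtype
    exact hind
  have hcard := hind'.fintype_card_le_finrank.trans hrank
  have hprod : ∏ c, m c = M ^ Fintype.card σ * q ^ r := by
    have : ∀ c, m c = M * (if ∃ j, b j = c then q else 1) := by
      intro c
      simp only [m]
      split_ifs <;> simp
    simp only [this]
    rw [Finset.prod_mul_distrib, Finset.prod_ite]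
    simp only [Finset.prod_const, Finset.card_univ, one_pow, mul_one]
    congr 2
    have : (Finset.univ.filter fun c => ∃ j, b j = c) = Finset.univ.image b := by
      ext c; simp
    rw [this, Finset.card_image_of_injective _ hb]
    simp
  simp only [Fintype.card_prod, Fintype.card_pi, Fintype.card_fin, Fintype.card_coe] at hcard
  rw [hprod] at hcard
  have hR : R + 1 ≤ M * q * (Fintype.card σ * d + 1) := by
    have : M ≤ M * q := Nat.le_mul_of_pos_right _ hq1
    calc R + 1 = M + Fintype.card σ * (M * q * d) := by simp only [R, M]; ring
      _ ≤ M * q + Fintype.card σ * (M * q * d) := by omega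
      _ = _ := by ring
  have h1 := hcard.trans (Nat.pow_le_pow_left hR _)
  have hMpos : 0 < M ^ Fintype.card σ := Nat.pow_pos (Nat.succ_pos _)
  apply Nat.le_of_mul_le_mul_left _ hMpos
  calc M ^ Fintype.card σ * (P.card * q ^ r) = P.card * (M ^ Fintype.card σ * q ^ r) := by ring
    _ ≤ _ := h1
    _ = _ := by rw [mul_pow, mul_pow]; ring

open Classical in
/-- Apply those derivations `D l` with `l ∈ s`, in order. -/
noncomputable def iterD {F R : Type*} [CommRing F] [CommRing R] [Algebra F R] :
    (m : ℕ) → (Fin m → Derivation F R R) → Set (Fin m) → R → R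
  | 0, _, _, g => g
  | m + 1, D, s, g =>
    if (0 : Fin (m + 1)) ∈ s then
      D 0 (iterD m (fun l => D l.succ) {l | l.succ ∈ s} g)
    else iterD m (fun l => D l.succ) {l | l.succ ∈ s} g

def ddSeq (k N : ℕ) : ℕ → ℕ
  | 0 => k + 1
  | j + 1 => ddSeq k N j + k + k * ((k + 1) * (N * ddSeq k N j))

theorem ddSeq_mono (k N : ℕ) : Monotone (ddSeq k N) := by
  apply monotone_nat_of_le_succ
  intro j
  simp only [ddSeq]
  omega

/-- Existence of jets of large dimension through a rational point. -/
theorem aux_jets (k N : ℕ) : ∃ C : ℕ, 1 ≤ C ∧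
    ∀ (F : Type) [Field F] [Fintype F] (σ : Type) [Fintype σ] [DecidableEq σ],
      Fintype.card σ = N → ∀ (Fs : Set (MvPolynomial σ F)), (∀ f ∈ Fs, f.totalDegree ≤ k) →
      ∀ K : Finset (σ → F), K.Nonempty → (∀ x ∈ K, ∀ f ∈ Fs, eval x f = 0) →
      ∃ (r : ℕ) (x : σ → F) (B : Finset σ)
        (E : σ → Derivation F (MvPolynomial σ F) (MvPolynomial σ F)) (u : MvPolynomial σ F),
        K.card * Fintype.card F ^ r ≤ C * Fintype.card F ^ N ∧ B.card ≤ r ∧ eval x u = 0 ∧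
        (∀ c c', c' ∉ B → E c (X c') = if c = c' then 1 - u ^ (k + 1) else 0) ∧
        (∀ f ∈ Fs, ∀ c : Fin k → σ,
          eval x (iterD k (fun l => E (c l)) Set.univ f) = 0) := by
  classical
  set dd := ddSeq k N with hdd
  have hmono : Monotone dd := ddSeq_mono k N
  have hd1 : ∀ j, k + 1 ≤ dd j := fun j => hmono (Nat.zero_le j)
  set DD := N * dd N with hDD
  refine ⟨2 ^ ((DD + 1) ^ N) * (2 * (N * dd N + 1) ^ N), Nat.mul_pos (by positivity)
    (by positivity), ?_⟩
  intro F _ _ σ _ _ hσ Fs hFs K hK hKF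
  obtain ⟨Z, hZK, hZne, hZcard, hZgen⟩ := aux_generic DD K hK
  let Good : ℕ → Prop := fun j => ∃ (f : Fin j → MvPolynomial σ F) (b : Fin j → σ),
    (∀ i, (f i).totalDegree ≤ dd j) ∧ (∀ i, ∀ x ∈ Z, eval x (f i) = 0) ∧
    ∃ x ∈ Z, eval x (Matrix.det (Matrix.of fun i l => pderiv (b l) (f i))) ≠ 0
  have hgood0 : Good 0 := by
    obtain ⟨x, hx⟩ := hZne
    exact ⟨Fin.elim0, Fin.elim0, fun i => i.elim0, fun i => i.elim0, x, hx, by simp⟩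
  have hgoodN : ∀ j, Good j → j ≤ N := by
    rintro j ⟨f, b, _, _, x, _, hx⟩
    have hb : Function.Injective b := by
      intro i l hil
      by_contra hne
      apply hx
      rw [Matrix.det_zero_of_column_eq hne (by intro t; simp [hil]), map_zero]
    have := Fintype.card_le_of_injective b hb
    simpa [hσ] using this
  obtain ⟨r, hr, hr'⟩ : ∃ r, Good r ∧ ¬ Good (r + 1) := by
    by_contra hcon
    push Not at hcon
    have : ∀ j, Good j := fun j => Nat.rec hgood0 (fun j hj => hcon j hj) j
    have := hgoodN _ (this (N + 1))
    omega
  have hrN := hgoodN r hr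
  obtain ⟨f, b, hfdeg, hfZ, x, hxZ, hx⟩ := hr
  set Δ := Matrix.det (Matrix.of fun i l => pderiv (b l) (f i)) with hΔ
  have hminor : ∀ (b' : Fin r → σ),
      (Matrix.det (Matrix.of fun i l => pderiv (b' l) (f i))).totalDegree ≤ N * dd r := by
    intro b'
    refine (aux_totalDegree_det _ (d := dd r) ?_).trans (Nat.mul_le_mul_right _ hrN)
    intro i l
    exact (aux_totalDegree_pderiv _ _).trans (hfdeg i)
  have hΔdeg : Δ.totalDegree ≤ DD :=
    (hminor b).trans (Nat.mul_le_mul_left _ (hmono hrN))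
  have hhalf := hZgen Δ hΔdeg ⟨x, hxZ, hx⟩
  have hbez := aux_bezout (r := r) (d := dd N) (by have := hd1 N; omega) f b
    (fun i => (hfdeg i).trans (hmono hrN)) (Z.filter (fun y => eval y Δ ≠ 0))
    (fun y hy i => hfZ i y (Finset.mem_filter.1 hy).1) (fun y hy => (Finset.mem_filter.1 hy).2)
  rw [hσ] at hbez hZcard
  set δ := eval x Δ with hδ
  let u : MvPolynomial σ F := 1 - C δ⁻¹ * Δ
  let θ : MvPolynomial σ F := (∑ l ∈ Finset.range (k + 1), u ^ l) * C δ⁻¹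
  let v : σ → Derivation F (MvPolynomial σ F) (MvPolynomial σ F) := fun c =>
    ∑ l : Fin (r + 1), ((-1) ^ (l : ℕ) * Matrix.det (Matrix.of fun i t =>
      pderiv ((Fin.cons c b : Fin (r + 1) → σ) (l.succAbove t)) (f i))) •
      pderiv ((Fin.cons c b : Fin (r + 1) → σ) l)
  have hvapp : ∀ c g, v c g = ∑ l : Fin (r + 1), ((-1) ^ (l : ℕ) *
      Matrix.det (Matrix.of fun i t =>
      pderiv ((Fin.cons c b : Fin (r + 1) → σ) (l.succAbove t)) (f i))) *
      pderiv ((Fin.cons c b : Fin (r + 1) → σ) l) g := by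
    intro c g
    simp only [v]
    rw [← Derivation.coeFnAddMonoidHom_apply, map_sum, Finset.sum_apply]
    rfl
  have hvdet : ∀ c g, v c g = Matrix.det (Matrix.of fun i l =>
      pderiv ((Fin.cons c b : Fin (r + 1) → σ) l)
        ((Fin.cons g f : Fin (r + 1) → MvPolynomial σ F) i)) := by
    intro c g
    rw [hvapp, Matrix.det_succ_row_zero]
    refine Finset.sum_congr rfl fun l _ => ?_
    have : (Matrix.of fun i l =>
      pderiv ((Fin.cons c b : Fin (r + 1) → σ) l)
        ((Fin.cons g f : Fin (r + 1) → MvPolynomial σ F) i)).submatrix Fin.succ l.succAbove =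
        Matrix.of fun i t =>
      pderiv ((Fin.cons c b : Fin (r + 1) → σ) (l.succAbove t)) (f i) := by
      ext i t
      simp
    rw [this]
    simp only [Matrix.of_apply, Fin.cons_zero]
    ring
  have hvdeg : ∀ c g, (v c g).totalDegree ≤ g.totalDegree + N * dd r := by
    intro c g
    rw [hvapp]
    apply totalDegree_finsetSum_le
    intro l _
    refine (totalDegree_mul _ _).trans ?_
    rw [add_comm]
    refine add_le_add (aux_totalDegree_pderiv _ _) ?_
    refine le_trans ?_ (hminor (fun t => (Fin.cons c b : Fin (r + 1) → σ) (l.succAbove t)))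
    rcases neg_one_pow_eq_or (MvPolynomial σ F) (l : ℕ) with h | h <;> rw [h] <;> simp
  have hvZ : ∀ c g, g.totalDegree ≤ dd (r + 1) → (∀ y ∈ Z, eval y g = 0) →
      ∀ y ∈ Z, eval y (v c g) = 0 := by
    intro c g hg hgZ y hy
    by_contra hne
    apply hr'
    refine ⟨Fin.cons g f, Fin.cons c b, ?_, ?_, y, hy, ?_⟩
    · intro i
      refine Fin.cases ?_ ?_ i
      · simpa using hg
      · intro i
        simpa using (hfdeg i).trans (hmono (Nat.le_succ r))
    · intro i
      refine Fin.cases ?_ ?_ i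
      · simpa using hgZ
      · intro i
        simpa using hfZ i
    · rw [← hvdet]
      exact hne
  have hudeg : u.totalDegree ≤ N * dd r := by
    refine (totalDegree_sub _ _).trans ?_
    rw [totalDegree_one]
    refine max_le (Nat.zero_le _) ?_
    refine (totalDegree_mul _ _).trans ?_
    rw [totalDegree_C, zero_add]
    exact hminor b
  have hθdeg : θ.totalDegree ≤ k * (N * dd r) := by
    refine (totalDegree_mul _ _).trans ?_
    rw [totalDegree_C, add_zero]
    apply totalDegree_finsetSum_le
    intro l hl
    refine (totalDegree_pow _ _).trans ?_
    exact Nat.mul_le_mul (by have := Finset.mem_range.1 hl; omega) hudeg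
  have hθΔ : θ * Δ = 1 - u ^ (k + 1) := by
    have h1 := geom_sum_mul u (k + 1)
    have h2 : C δ⁻¹ * Δ = 1 - u := by simp [u]
    calc θ * Δ = (∑ l ∈ Finset.range (k + 1), u ^ l) * (C δ⁻¹ * Δ) := by simp only [θ]; ring
      _ = -((∑ l ∈ Finset.range (k + 1), u ^ l) * (u - 1)) := by rw [h2]; ring
      _ = _ := by rw [h1]; ring
  let E : σ → Derivation F (MvPolynomial σ F) (MvPolynomial σ F) := fun c => θ • v c
  have hEapp : ∀ c g, E c g = θ * v c g := fun c g => rfl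
  have hEdeg : ∀ c g, (E c g).totalDegree ≤ g.totalDegree + (k + 1) * (N * dd r) := by
    intro c g
    rw [hEapp]
    refine (totalDegree_mul _ _).trans ?_
    have := hvdeg c g
    have h2 : (k + 1) * (N * dd r) = k * (N * dd r) + N * dd r := by ring
    omega
  refine ⟨r, x, Finset.univ.image b, E, u, ?_, ?_, ?_, ?_, ?_⟩
  · calc K.card * Fintype.card F ^ r
        ≤ (2 ^ ((DD + 1) ^ N) * (2 * (Z.filter (fun y => eval y Δ ≠ 0)).card)) *
          Fintype.card F ^ r :=
          Nat.mul_le_mul_right _ (hZcard.trans (Nat.mul_le_mul_left _ hhalf))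
      _ = 2 ^ ((DD + 1) ^ N) * 2 * ((Z.filter (fun y => eval y Δ ≠ 0)).card *
          Fintype.card F ^ r) := by ring
      _ ≤ 2 ^ ((DD + 1) ^ N) * 2 * ((N * dd N + 1) ^ N * Fintype.card F ^ N) :=
          Nat.mul_le_mul_left _ hbez
      _ = _ := by ring
  · exact Finset.card_image_le.trans (by simp)
  · simp only [u, map_sub, map_one, map_mul, eval_C]
    rw [← hδ, inv_mul_cancel₀ hx, sub_self]
  · intro c c' hc'
    have hc'' : ∀ l, c' ≠ b l := by
      intro l hl
      apply hc'
      simp [hl]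
    rw [hEapp, hvapp, Fin.sum_univ_succ]
    have h1 : ∀ l : Fin r, pderiv (b l) (X c' : MvPolynomial σ F) = 0 := by
      intro l
      simp [pderiv_X, hc'' l]
    simp only [Fin.val_zero, pow_zero, one_mul, Fin.cons_zero, Fin.zero_succAbove, Fin.cons_succ]
    simp only [h1, mul_zero, Finset.sum_const_zero, add_zero]
    rw [← hΔ, ← mul_assoc, hθΔ, pderiv_X]
    by_cases hcc : c = c'
    · subst hcc; simp
    · simp [hcc, Ne.symm hcc]
  · intro g hg c
    have key : ∀ m, m ≤ k → ∀ c : Fin m → σ,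
        (iterD m (fun l => E (c l)) Set.univ g).totalDegree ≤ k + m * ((k + 1) * (N * dd r)) ∧
        ∀ y ∈ Z, eval y (iterD m (fun l => E (c l)) Set.univ g) = 0 := by
      intro m
      induction m with
      | zero =>
        intro _ c
        simp only [iterD]
        exact ⟨by simpa using hFs g hg, fun y hy => hKF y (hZK hy) g hg⟩
      | succ m ih =>
        intro hm c
        obtain ⟨h1, h2⟩ := ih (by omega) (fun l => c l.succ)
        simp only [iterD, Set.mem_univ, if_true, Set.ofPred_true]
        set g' := iterD m (fun l => E (c l.succ)) Set.univ g
        constructor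
        · have := hEdeg (c 0) g'
          rw [add_mul, one_mul]
          omega
        · intro y hy
          rw [hEapp, map_mul, hvZ (c 0) g' _ h2 y hy, mul_zero]
          refine h1.trans ?_
          have h3 : dd (r + 1) = dd r + k + k * ((k + 1) * (N * dd r)) := rfl
          have h4 : m * ((k + 1) * (N * dd r)) ≤ k * ((k + 1) * (N * dd r)) :=
            Nat.mul_le_mul_right _ (by omega)
          omega
    exact (key k le_rfl c).2 x hxZ

section iter
variable {F R : Type*} [CommRing F] [CommRing R] [Algebra F R]

theorem iterD_sum {ι : Type*} (t : Finset ι) : ∀ (m : ℕ) (D : Fin m → Derivation F R R)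
    (s : Set (Fin m)) (a : ι → F) (g : ι → R),
    iterD m D s (∑ i ∈ t, a i • g i) = ∑ i ∈ t, a i • iterD m D s (g i) := by
  classical
  intro m
  induction m with
  | zero => intro D s a g; rfl
  | succ m ih =>
    intro D s a g
    simp only [iterD]
    split_ifs
    · rw [ih, map_sum]
      simp
    · rw [ih]

theorem iterD_congr : ∀ (m : ℕ) (D D' : Fin m → Derivation F R R) (s : Set (Fin m)) (g : R),
    (∀ l ∈ s, D l = D' l) → iterD m D s g = iterD m D' s g := by
  classical
  intro m
  induction m with
  | zero => intros; rfl
  | succ m ih =>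
    intro D D' s g h
    simp only [iterD]
    rw [ih (fun l => D l.succ) (fun l => D' l.succ) {l | l.succ ∈ s} g (fun l hl => h _ hl)]
    split_ifs with h0
    · rw [h 0 h0]
    · rfl

theorem iterD_empty : ∀ (m : ℕ) (D : Fin m → Derivation F R R) (g : R),
    iterD m D ∅ g = g := by
  classical
  intro m
  induction m with
  | zero => intros; rfl
  | succ m ih =>
    intro D g
    simp only [iterD, Set.mem_empty_iff_false, if_false]
    exact ih _ _

theorem deriv_prod {ι : Type*} [DecidableEq ι] (D : Derivation F R R) (t : Finset ι)
    (g : ι → R) :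
    D (∏ i ∈ t, g i) = ∑ i ∈ t, ∏ j ∈ t, if i = j then D (g j) else g j := by
  induction t using Finset.induction_on with
  | empty => simp
  | insert a t ha ih =>
    rw [Finset.prod_insert ha, Derivation.leibniz, Finset.sum_insert ha, ih,
      Finset.prod_insert ha, if_pos rfl, add_comm]
    congr 1
    · rw [smul_eq_mul, mul_comm]
      congr 1
      apply Finset.prod_congr rfl
      intro j hj
      rw [if_neg]
      rintro rfl
      exact ha hj
    · rw [smul_eq_mul, Finset.mul_sum]
      apply Finset.sum_congr rfl
      intro i hi
      rw [Finset.prod_insert ha, if_neg]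
      rintro rfl
      exact ha hi

theorem iterD_prod {ι : Type*} [Fintype ι] [DecidableEq ι] (g : ι → R) :
    ∀ (m : ℕ) (D : Fin m → Derivation F R R),
    iterD m D Set.univ (∏ i, g i) =
      ∑ π : Fin m → ι, ∏ i, iterD m D {l | π l = i} (g i) := by
  classical
  intro m
  induction m with
  | zero => intro D; simp [iterD]
  | succ m ih =>
    intro D
    have h1 : iterD (m + 1) D Set.univ (∏ i, g i) =
        D 0 (iterD m (fun l => D l.succ) Set.univ (∏ i, g i)) := by
      simp [iterD]
    rw [h1, ih, map_sum, ← (Fin.consEquiv (fun _ => ι)).sum_comp, Fintype.sum_prod_type,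
      Finset.sum_comm]
    apply Finset.sum_congr rfl
    intro π _
    rw [deriv_prod]
    apply Finset.sum_congr rfl
    intro i0 _
    apply Finset.prod_congr rfl
    intro j _
    simp [iterD, Fin.consEquiv]

theorem iterD_struct (k : ℕ) (u g0 : R) : ∀ (m : ℕ) (D : Fin m → Derivation F R R)
    (P : Fin m → Prop) [DecidablePred P] (s : Set (Fin m)),
    (∀ l, D l g0 = if P l then 1 - u ^ (k + 1) else 0) →
    (s = ∅ → iterD m D s g0 = g0) ∧
    (∀ l, s = {l} → iterD m D s g0 = if P l then 1 - u ^ (k + 1) else 0) ∧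
    (s.Nontrivial → u ^ (k + 1 - m) ∣ iterD m D s g0) := by
  classical
  intro m
  induction m with
  | zero =>
    intro D P _ s h
    refine ⟨fun _ => rfl, fun l => l.elim0, ?_⟩
    rintro ⟨a, _⟩
    exact a.elim0
  | succ m ih =>
    intro D P _ s h
    obtain ⟨h1, h2, h3⟩ := ih (fun l => D l.succ) (fun l => P l.succ) {l | l.succ ∈ s}
      (fun l => h l.succ)
    refine ⟨?_, ?_, ?_⟩
    · rintro rfl
      simp only [iterD, Set.mem_empty_iff_false, if_false]
      exact h1 (by ext; simp)
    · rintro l rfl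
      revert h1 h2
      refine Fin.cases ?_ (fun l' => ?_) l
      · intro h1 _
        have h1' := h1 (by ext a; simp [Fin.succ_ne_zero])
        simp only [iterD]
        rw [if_pos (Set.mem_singleton _), h1']
        exact h 0
      · intro _ h2
        simp only [iterD]
        rw [if_neg (fun h => Fin.succ_ne_zero l' (Set.mem_singleton_iff.1 h).symm)]
        exact h2 l' (by ext a; simp)
    · intro hs
      have hdvd : ∀ (D0 : Derivation F R R) (e : ℕ) (g : R), u ^ (e + 1) ∣ g → u ^ e ∣ D0 g := by
        rintro D0 e g ⟨w, rfl⟩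
        rw [Derivation.leibniz, Derivation.leibniz_pow, smul_eq_mul, smul_eq_mul]
        apply dvd_add
        · exact Dvd.dvd.mul_right (pow_dvd_pow _ (Nat.le_succ e)) _
        · simp only [Nat.add_sub_cancel, smul_eq_mul, nsmul_eq_mul]
          exact ⟨w * ((e + 1 : ℕ) * D0 u), by ring⟩
      simp only [iterD]
      split_ifs with h0
      · rcases Set.eq_empty_or_nonempty {l : Fin m | l.succ ∈ s} with he | hne
        · exfalso
          obtain ⟨a, ha, ha0⟩ := hs.exists_ne 0
          obtain ⟨a', rfl⟩ := Fin.exists_succ_eq.2 ha0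
          exact (Set.eq_empty_iff_forall_notMem.1 he a') ha
        · rcases hne.exists_eq_singleton_or_nontrivial with ⟨l, hl⟩ | hnt
          · rw [h2 l hl]
            split_ifs
            · rw [map_sub, Derivation.map_one_eq_zero, zero_sub, dvd_neg]
              refine (pow_dvd_pow _ ?_).trans (hdvd (D 0) k _ dvd_rfl)
              omega
            · simp
          · have h4 := h3 hnt
            by_cases hm : m ≤ k
            · apply hdvd
              rwa [show k + 1 - (m + 1) + 1 = k + 1 - m by omega]
            · rw [show k + 1 - (m + 1) = 0 by omega]
              simp
      · refine (pow_dvd_pow _ ?_).trans (h3 ?_)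
        · omega
        · obtain ⟨a, ha, b, hb, hab⟩ := hs
          obtain ⟨a', rfl⟩ := Fin.exists_succ_eq.2 (fun h : a = 0 => h0 (h ▸ ha))
          obtain ⟨b', rfl⟩ := Fin.exists_succ_eq.2 (fun h : b = 0 => h0 (h ▸ hb))
          exact ⟨a', ha, b', hb, fun h => hab (by rw [h])⟩

end iter

section comb

theorem hasPR_of_fintype {ι : Type*} {β : ι → Type*} {F : Type*} [CommRing F]
    (T : ((i : ι) → β i) → F) {J : Type*} [Fintype J]
    (S : J → Set ι) (p q : J → ((i : ι) → β i) → F)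
    (h : ∀ j, (S j).Nonempty ∧ S j ≠ Set.univ ∧
      DependsOnlyOn (p j) (S j) ∧ DependsOnlyOn (q j) (S j)ᶜ)
    (hT : ∀ I, T I = ∑ j, p j I * q j I) : partitionRank T ≤ Fintype.card J := by
  apply Nat.sInf_le
  let e := (Fintype.equivFin J).symm
  refine ⟨fun j => S (e j), fun j => p (e j), fun j => q (e j), fun j => h (e j), ?_⟩
  intro I
  rw [hT I]
  exact (e.sum_comp (fun j => p j I * q j I)).symm

/-- The polynomials whose common zero set is the kernel. -/
noncomputable def fpoly {k : ℕ} {d : Fin (k + 1) → ℕ} {F : Type*} [Field F]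
    (T : ((i : Fin (k + 1)) → Fin (d i)) → F) (y : Fin (d (Fin.last k))) :
    MvPolynomial ((i : Fin k) × Fin (d i.castSucc)) F :=
  ∑ J : (i : Fin k) → Fin (d i.castSucc),
    T (Fin.snoc (α := fun i => Fin (d i)) J y) •
      ∏ i, (X ⟨i, J i⟩ : MvPolynomial ((i : Fin k) × Fin (d i.castSucc)) F)

theorem aux_comb {k : ℕ} {d : Fin (k + 1) → ℕ} {F : Type*} [Field F]
    (T : ((i : Fin (k + 1)) → Fin (d i)) → F)
    (x : ((i : Fin k) × Fin (d i.castSucc)) → F)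
    (B : Finset ((i : Fin k) × Fin (d i.castSucc)))
    (E : ((i : Fin k) × Fin (d i.castSucc)) →
      Derivation F (MvPolynomial ((i : Fin k) × Fin (d i.castSucc)) F)
        (MvPolynomial ((i : Fin k) × Fin (d i.castSucc)) F))
    (u : MvPolynomial ((i : Fin k) × Fin (d i.castSucc)) F) (hu : eval x u = 0)
    (hE : ∀ c c', c' ∉ B → E c (X c') = if c = c' then 1 - u ^ (k + 1) else 0)
    (h0 : ∀ y, ∀ c : Fin k → ((i : Fin k) × Fin (d i.castSucc)),
          eval x (iterD k (fun l => E (c l)) Set.univ (fpoly T y)) = 0) :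
    partitionRank T ≤ (2 ^ k - 1) * B.card := by
  classical
  let cI : ((i : Fin (k + 1)) → Fin (d i)) → Fin k → ((i : Fin k) × Fin (d i.castSucc)) :=
    fun I l => ⟨l, I l.castSucc⟩
  let φ : ((i : Fin (k + 1)) → Fin (d i)) → Set (Fin k) →
      ((i : Fin k) × Fin (d i.castSucc)) → F :=
    fun I S c => eval x (iterD k (fun l => E (cI I l)) S (X c))
  let ε : ((i : Fin (k + 1)) → Fin (d i)) → Set (Fin k) →
      ((i : Fin k) × Fin (d i.castSucc)) → F :=
    fun I S c => if S = ∅ then x c else if ∃ l, S = {l} ∧ cI I l = c then 1 else 0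
  let p : ((i : Fin (k + 1)) → Fin (d i)) → Set (Fin k) →
      ((i : Fin k) × Fin (d i.castSucc)) → F := fun I S c => φ I S c - ε I S c
  -- dependence
  have hdφ : ∀ I I' S c, (∀ l ∈ S, cI I l = cI I' l) → φ I S c = φ I' S c := by
    intro I I' S c h
    simp only [φ]
    rw [iterD_congr k _ (fun l => E (cI I' l)) S (X c) (fun l hl => by rw [h l hl])]
  have hdε : ∀ I I' S c, (∀ l ∈ S, cI I l = cI I' l) → ε I S c = ε I' S c := by
    intro I I' S c h
    simp only [ε]
    have : (∃ l, S = {l} ∧ cI I l = c) ↔ (∃ l, S = {l} ∧ cI I' l = c) := by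
      constructor
      · rintro ⟨l, hl, hc⟩
        exact ⟨l, hl, by rw [← h l (by simp [hl])]; exact hc⟩
      · rintro ⟨l, hl, hc⟩
        exact ⟨l, hl, by rw [h l (by simp [hl])]; exact hc⟩
    simp only [this]
  -- vanishing of p
  have hp0 : ∀ I c, p I ∅ c = 0 := by
    intro I c
    simp [p, φ, ε, iterD_empty]
  have hpB : ∀ I S c, c ∉ B → p I S c = 0 := by
    intro I S c hc
    obtain ⟨h1, h2, h3⟩ := iterD_struct (F := F) k u (X c) k (fun l => E (cI I l))
      (fun l => cI I l = c) S (fun l => hE _ c hc)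
    rcases S.eq_empty_or_nonempty with rfl | hne
    · exact hp0 I c
    rcases hne.exists_eq_singleton_or_nontrivial with ⟨l, hl⟩ | hnt
    · have h4 := h2 l hl
      simp only [p, φ, ε]
      rw [h4, if_neg hne.ne_empty]
      have : (∃ l, S = {l} ∧ cI I l = c) ↔ cI I l = c := by
        rw [hl]
        constructor
        · rintro ⟨l', hl', h⟩
          rw [Set.singleton_eq_singleton_iff.1 hl']
          exact h
        · intro h
          exact ⟨l, rfl, h⟩
      simp only [this]
      split_ifs <;> simp [hu]
    · have h4 := h3 hnt
      rw [Nat.add_sub_cancel_left, pow_one] at h4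
      obtain ⟨w, hw⟩ := h4
      simp only [p, φ, ε]
      rw [hw, if_neg hne.ne_empty, if_neg, map_mul, hu, zero_mul, sub_zero]
      rintro ⟨l, hl, _⟩
      rw [hl] at hnt
      exact Set.not_nontrivial_singleton hnt
  -- the fundamental relation
  have hrel : ∀ I, ∑ J : (i : Fin k) → Fin (d i.castSucc), ∑ π : Fin k → Fin k,
      T (Fin.snoc (α := fun i => Fin (d i)) J (I (Fin.last k))) *
        ∏ i, φ I {l | π l = i} ⟨i, J i⟩ = 0 := by
    intro I
    have h1 := h0 (I (Fin.last k)) (cI I)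
    rw [fpoly, iterD_sum] at h1
    simp only [iterD_prod, map_sum, smul_eval, map_prod, Finset.mul_sum] at h1
    exact h1
  have hmain : ∀ I, ∑ J : (i : Fin k) → Fin (d i.castSucc), ∑ π : Fin k → Fin k,
      T (Fin.snoc (α := fun i => Fin (d i)) J (I (Fin.last k))) *
        ∏ i, ε I {l | π l = i} ⟨i, J i⟩ = T I := by
    intro I
    have hclaim : ∀ (J : (i : Fin k) → Fin (d i.castSucc)) (π : Fin k → Fin k),
        (∏ i, ε I {l | π l = i} ⟨i, J i⟩) ≠ 0 → J = (fun i : Fin k => I i.castSucc) ∧ π = id := by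
      intro J π hne
      rw [Finset.prod_ne_zero_iff] at hne
      have h1 : ∀ l, cI I l = ⟨π l, J (π l)⟩ := by
        intro l
        have h2 := hne (π l) (Finset.mem_univ _)
        simp only [ε] at h2
        have hl : l ∈ {l' | π l' = π l} := rfl
        rw [if_neg (Set.nonempty_of_mem hl).ne_empty] at h2
        simp only [ne_eq, ite_eq_right_iff, one_ne_zero, imp_false, not_not] at h2
        obtain ⟨l', hl', hc⟩ := h2
        rw [hl', Set.mem_singleton_iff] at hl
        rw [hl] at hc ⊢
        exact hc
      have hπ : π = id := by
        funext l
        exact (congrArg Sigma.fst (h1 l)).symm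
      refine ⟨?_, hπ⟩
      subst hπ
      funext l
      have h2 := h1 l
      simp only [cI, id] at h2
      exact (eq_of_heq (Sigma.mk.inj h2).2).symm
    rw [Finset.sum_eq_single (fun i : Fin k => I i.castSucc), Finset.sum_eq_single id]
    · have h1 : ∏ i, ε I {l | id l = i} ⟨i, I i.castSucc⟩ = 1 := by
        apply Finset.prod_eq_one
        intro i _
        simp only [ε]
        have : {l | id l = i} = ({i} : Set (Fin k)) := by ext; simp
        rw [this, if_neg (Set.singleton_ne_empty i), if_pos ⟨i, rfl, rfl⟩]
      rw [h1, mul_one]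
      congr 1
      exact Fin.snoc_init_self (α := fun i => Fin (d i)) I
    · intro π _ hπ
      by_contra hne
      exact hπ (hclaim _ π (right_ne_zero_of_mul hne)).2
    · simp
    · intro J _ hJ
      apply Finset.sum_eq_zero
      intro π _
      by_contra hne
      exact hJ (hclaim J π (right_ne_zero_of_mul hne)).1
    · simp
  let rest : ((i : Fin (k + 1)) → Fin (d i)) → ((i : Fin k) → Fin (d i.castSucc)) →
      (Fin k → Fin k) → Fin k → F := fun I J π i =>
    (∏ j with j < i, ε I {l | π l = j} ⟨j, J j⟩) * ∏ j with i < j, φ I {l | π l = j} ⟨j, J j⟩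
  have hTI : ∀ I, T I = -∑ J : (i : Fin k) → Fin (d i.castSucc), ∑ π : Fin k → Fin k, ∑ i,
      p I {l | π l = i} ⟨i, J i⟩ *
        (T (Fin.snoc (α := fun i => Fin (d i)) J (I (Fin.last k))) * rest I J π i) := by
    intro I
    rw [← hmain I, eq_neg_iff_add_eq_zero, ← hrel I, ← Finset.sum_add_distrib]
    apply Finset.sum_congr rfl
    intro J _
    rw [← Finset.sum_add_distrib]
    apply Finset.sum_congr rfl
    intro π _
    have h1 := Finset.prod_sub_ordered Finset.univ (fun i => φ I {l | π l = i} ⟨i, J i⟩)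
      (fun i => p I {l | π l = i} ⟨i, J i⟩)
    have h2 : ∀ i, φ I {l | π l = i} ⟨i, J i⟩ - p I {l | π l = i} ⟨i, J i⟩ =
        ε I {l | π l = i} ⟨i, J i⟩ := by
      intro i; simp [p]
    simp only [h2] at h1
    rw [h1, mul_sub, Finset.mul_sum]
    rw [sub_add_eq_add_sub, sub_eq_iff_eq_add]
    congr 1
    apply Finset.sum_congr rfl
    intro i _
    simp only [rest]
    ring
  let Idx := {S : Set (Fin k) // S ≠ ∅} × B
  let q : Idx → ((i : Fin (k + 1)) → Fin (d i)) → F := fun sb I =>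
    -∑ J : (i : Fin k) → Fin (d i.castSucc), ∑ π : Fin k → Fin k, ∑ i : Fin k,
      if {l | π l = i} = sb.1.1 ∧ (⟨i, J i⟩ : (i : Fin k) × Fin (d i.castSucc)) = sb.2.1 then
        T (Fin.snoc (α := fun i => Fin (d i)) J (I (Fin.last k))) * rest I J π i else 0
  have hcard : Fintype.card Idx = (2 ^ k - 1) * B.card := by
    simp only [Idx, Fintype.card_prod, Fintype.card_coe]
    congr 1
    rw [Fintype.card_subtype_compl, Fintype.card_set, Fintype.card_fin,
      Fintype.card_subtype_eq]
  rw [← hcard]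
  refine hasPR_of_fintype T (fun sb : Idx => Fin.castSucc '' sb.1.1)
    (fun sb I => p I sb.1.1 sb.2.1) q ?_ ?_
  · rintro ⟨⟨S, hS⟩, ⟨b, hb⟩⟩
    refine ⟨?_, ?_, ?_, ?_⟩
    · exact (Set.nonempty_iff_ne_empty.2 hS).image _
    · intro heq
      have : Fin.last k ∈ Fin.castSucc '' S := by rw [heq]; trivial
      obtain ⟨l, _, hl⟩ := this
      exact (Fin.castSucc_ne_last l) hl
    · intro I I' h
      have h1 : ∀ l ∈ S, cI I l = cI I' l := by
        intro l hl
        simp only [cI]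
        rw [h l.castSucc ⟨l, hl, rfl⟩]
      simp only [p]
      rw [hdφ I I' S b h1, hdε I I' S b h1]
    · intro I I' h
      have hlast : I (Fin.last k) = I' (Fin.last k) := by
        apply h
        rintro ⟨l, _, hl⟩
        exact (Fin.castSucc_ne_last l) hl
      have h1 : ∀ l, l ∉ S → cI I l = cI I' l := by
        intro l hl
        simp only [cI]
        rw [h l.castSucc]
        rintro ⟨l', hl', hll⟩
        rw [Fin.castSucc_injective _ hll] at hl'
        exact hl hl'
      simp only [q]
      congr 1
      refine Finset.sum_congr rfl fun J _ => Finset.sum_congr rfl fun π _ =>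
        Finset.sum_congr rfl fun i _ => ?_
      split_ifs with hc
      · rw [hlast]
        congr 1
        simp only [rest]
        have h2 : ∀ j, j ≠ i → ∀ l ∈ {l | π l = j}, cI I l = cI I' l := by
          intro j hj l hl
          apply h1
          rw [← hc.1]
          intro hl'
          exact hj (hl.symm.trans hl')
        congr 1
        · apply Finset.prod_congr rfl
          intro j hj
          exact hdε _ _ _ _ (h2 j (Finset.mem_filter.1 hj).2.ne)
        · apply Finset.prod_congr rfl
          intro j hj
          exact hdφ _ _ _ _ (h2 j (Finset.mem_filter.1 hj).2.ne')
      · rfl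
  · intro I
    rw [hTI I]
    simp only [q, mul_neg, Finset.sum_neg_distrib, Finset.mul_sum]
    congr 1
    conv_rhs => rw [Finset.sum_comm]
    apply Finset.sum_congr rfl
    intro J _
    conv_rhs => rw [Finset.sum_comm]
    apply Finset.sum_congr rfl
    intro π _
    conv_rhs => rw [Finset.sum_comm]
    apply Finset.sum_congr rfl
    intro i _
    by_cases hS : ({l | π l = i} : Set (Fin k)) = ∅
    · rw [hS, hp0, zero_mul, eq_comm]
      apply Finset.sum_eq_zero
      rintro ⟨⟨S, hS'⟩, b⟩ _
      rw [if_neg, mul_zero]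
      rintro ⟨h, _⟩
      exact hS' h.symm
    by_cases hb : (⟨i, J i⟩ : (i : Fin k) × Fin (d i.castSucc)) ∈ B
    · rw [Finset.sum_eq_single (⟨⟨_, hS⟩, ⟨_, hb⟩⟩ : Idx)]
      · simp
      · rintro ⟨⟨S, hS'⟩, ⟨b, hb'⟩⟩ _ hne
        rw [if_neg, mul_zero]
        rintro ⟨h, h'⟩
        apply hne
        simp only at h h'
        subst h
        subst h'
        rfl
      · simp
    · rw [hpB _ _ _ hb, zero_mul, eq_comm]
      apply Finset.sum_eq_zero
      rintro ⟨S, ⟨b, hb'⟩⟩ _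
      rw [if_neg, mul_zero]
      rintro ⟨_, h⟩
      simp only at h
      rw [h] at hb
      exact hb hb'

end comb

theorem fpoly_degree {k : ℕ} {d : Fin (k + 1) → ℕ} {F : Type*} [Field F]
    (T : ((i : Fin (k + 1)) → Fin (d i)) → F) (y : Fin (d (Fin.last k))) :
    (fpoly T y).totalDegree ≤ k := by
  apply totalDegree_finsetSum_le
  intro J _
  refine (totalDegree_smul_le _ _).trans ?_
  refine (totalDegree_finsetProd _ _).trans ?_
  simp [totalDegree_X]

theorem fpoly_eval {k : ℕ} {d : Fin (k + 1) → ℕ} {F : Type*} [Field F]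
    (T : ((i : Fin (k + 1)) → Fin (d i)) → F) (y : Fin (d (Fin.last k)))
    (x : (i : Fin k) → Fin (d i.castSucc) → F) :
    eval (fun c : (i : Fin k) × Fin (d i.castSucc) => x c.1 c.2) (fpoly T y) =
      mlEval T (Fin.snoc (α := fun i => Fin (d i) → F) x (Pi.single y 1)) := by
  classical
  rw [mlEval, ← (Fin.snocEquiv (fun i => Fin (d i))).sum_comp, Fintype.sum_prod_type,
    Finset.sum_eq_single y]
  · rw [fpoly, map_sum]
    apply Finset.sum_congr rfl
    intro J _
    rw [Fin.prod_univ_castSucc]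
    simp [smul_eval, Fin.snocEquiv]
  · intro b _ hb
    apply Finset.sum_eq_zero
    intro J _
    rw [Fin.prod_univ_castSucc]
    simp [Fin.snocEquiv, hb]
  · simp

end Aux
/-- **Theorem 1 (main theorem)**: for every `k ≥ 2` (here the tensor has `k+1 ≥ 2` modes)
and every `n` there is a bound `F = F(n,k)` such that over any finite field `𝔽` with
`|𝔽| > F`, every `(k+1)`-tensor `T` with all mode sizes at most `n` satisfies
`PR(T) ≤ (2^k − 1)·AR(T) + 1`, where the analytic rank is
`AR(T) = N − log_{|𝔽|} |K|`, `N = n_1 + ⋯ + n_k` being the total dimension of the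
first `k` variable blocks and `K` the set of points of `𝔽^{n_1} × ⋯ × 𝔽^{n_k}` at which
the multilinear map `T̃` (the slicing of `T` along the last axis) vanishes. -/
theorem statement0 (k : ℕ) (hk : 1 ≤ k) (n : ℕ) :
    ∃ F : ℕ, ∀ (𝔽 : Type) [Field 𝔽] [Fintype 𝔽],
      F < Fintype.card 𝔽 →
      ∀ d : Fin (k+1) → ℕ, (∀ i, d i ≤ n) →
      ∀ T : ((i : Fin (k+1)) → Fin (d i)) → 𝔽,
      (partitionRank T : ℝ) ≤
        ((2:ℝ) ^ k - 1) *
          ((∑ i : Fin k, (d i.castSucc : ℝ)) -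
            Real.logb (Fintype.card 𝔽)
              ({x : (i : Fin k) → (Fin (d i.castSucc) → 𝔽) |
                ∀ y : Fin (d (Fin.last k)) → 𝔽,
                  mlEval T (Fin.snoc x y) = 0}.ncard)) + 1 := by
  classical
  choose C hC1 hC using aux_jets k
  refine ⟨∑ N ∈ Finset.range (k * n + 1), C N ^ (2 ^ k), ?_⟩
  intro 𝔽 _ _ hq d hd T
  set N := ∑ i : Fin k, d i.castSucc with hN
  have hNle : N ≤ k * n := by
    calc N ≤ ∑ _i : Fin k, n := Finset.sum_le_sum fun i _ => hd _
      _ = k * n := by simp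
  have hCq : C N ^ (2 ^ k) ≤ Fintype.card 𝔽 := by
    refine le_trans ?_ hq.le
    exact Finset.single_le_sum (f := fun N => C N ^ (2 ^ k)) (fun _ _ => Nat.zero_le _)
      (Finset.mem_range.2 (Nat.lt_succ_of_le hNle))
  set q := Fintype.card 𝔽 with hqdef
  have hq2 : 1 < q := Fintype.one_lt_card
  set Kst := {x : (i : Fin k) → (Fin (d i.castSucc) → 𝔽) |
                ∀ y : Fin (d (Fin.last k)) → 𝔽, mlEval T (Fin.snoc x y) = 0} with hKst
  let K : Finset (((i : Fin k) × Fin (d i.castSucc)) → 𝔽) :=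
    Finset.univ.filter (fun z => ∀ y, MvPolynomial.eval z (fpoly T y) = 0)
  let flat : ((i : Fin k) → (Fin (d i.castSucc) → 𝔽)) →
      (((i : Fin k) × Fin (d i.castSucc)) → 𝔽) := fun x c => x c.1 c.2
  have hflat : Function.Injective flat := by
    intro x x' h
    funext i j
    exact congrFun h ⟨i, j⟩
  have hcardK : Kst.ncard ≤ K.card := by
    rw [← Set.ncard_coe_finset]
    refine Set.ncard_le_ncard_of_injOn flat ?_ hflat.injOn (Finset.finite_toSet _)
    intro x hx
    simp only [K, Finset.coe_filter, Finset.mem_univ, true_and, Set.mem_ofPred_eq]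
    intro y
    rw [fpoly_eval]
    exact hx _
  have hzero : (0 : (i : Fin k) → (Fin (d i.castSucc) → 𝔽)) ∈ Kst := by
    intro y
    rw [mlEval]
    apply Finset.sum_eq_zero
    intro I _
    rw [Fin.prod_univ_castSucc, Finset.prod_eq_zero (Finset.mem_univ (⟨0, hk⟩ : Fin k))]
    · rw [zero_mul, mul_zero]
    · rw [Fin.snoc_castSucc (α := fun i => Fin (d i) → 𝔽)]
      rfl
  have hKpos : 0 < Kst.ncard := (Set.ncard_pos (Set.toFinite _)).2 ⟨_, hzero⟩
  have hKne : K.Nonempty := Finset.card_pos.1 (lt_of_lt_of_le hKpos hcardK)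
  obtain ⟨r, x, B, E, u, h1, h2, h3, h4, h5⟩ := hC N 𝔽 ((i : Fin k) × Fin (d i.castSucc))
    (by simp [hN]) (Set.range (fpoly T)) (by rintro f ⟨y, rfl⟩; exact fpoly_degree T y) K hKne
    (by rintro z hz f ⟨y, rfl⟩; exact (Finset.mem_filter.1 hz).2 y)
  have hPR : partitionRank T ≤ (2 ^ k - 1) * r :=
    (aux_comb T x B E u h3 h4 (fun y c => h5 _ ⟨y, rfl⟩ c)).trans (Nat.mul_le_mul_left _ h2)
  have hcount : Kst.ncard * q ^ r ≤ C N * q ^ N :=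
    (Nat.mul_le_mul_right _ hcardK).trans h1
  have hq1R : (1 : ℝ) < q := by exact_mod_cast hq2
  have hq0R : (0 : ℝ) < q := by positivity
  have hKR : (0 : ℝ) < Kst.ncard := by exact_mod_cast hKpos
  have hCR : (0 : ℝ) < C N := by exact_mod_cast hC1 N
  have hlog : Real.logb q Kst.ncard + r ≤ Real.logb q (C N) + N := by
    have h6 : ((Kst.ncard : ℝ)) * (q : ℝ) ^ r ≤ (C N : ℝ) * (q : ℝ) ^ N := by
      exact_mod_cast hcount
    have h7 := Real.logb_le_logb_of_le hq1R (by positivity) h6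
    rw [Real.logb_mul hKR.ne' (by positivity), Real.logb_mul hCR.ne' (by positivity),
      Real.logb_pow, Real.logb_pow, Real.logb_self_eq_one hq1R] at h7
    simpa using h7
  have hlogC : (2 : ℝ) ^ k * Real.logb q (C N) ≤ 1 := by
    have h6 : (C N : ℝ) ^ (2 ^ k) ≤ (q : ℝ) := by exact_mod_cast hCq
    have h7 := Real.logb_le_logb_of_le hq1R (by positivity) h6
    rw [Real.logb_pow, Real.logb_self_eq_one hq1R] at h7
    simpa using h7
  have hlogC0 : 0 ≤ Real.logb q (C N) :=
    Real.logb_nonneg hq1R (by exact_mod_cast hC1 N)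
  have hNR : (∑ i : Fin k, (d i.castSucc : ℝ)) = (N : ℝ) := by
    rw [hN]; push_cast; rfl
  rw [hNR]
  have h2k : (1 : ℝ) ≤ 2 ^ k := one_le_pow₀ (by norm_num)
  have hPRR : (partitionRank T : ℝ) ≤ ((2 : ℝ) ^ k - 1) * r := by
    have : (partitionRank T : ℝ) ≤ (((2 ^ k - 1) * r : ℕ) : ℝ) := by exact_mod_cast hPR
    rwa [Nat.cast_mul, Nat.cast_sub Nat.one_le_two_pow, Nat.cast_pow, Nat.cast_one,
      Nat.cast_ofNat] at this
  have h8 : ((2 : ℝ) ^ k - 1) * r ≤ ((2 : ℝ) ^ k - 1) *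
      ((N - Real.logb q Kst.ncard) + Real.logb q (C N)) :=
    mul_le_mul_of_nonneg_left (by linarith) (by linarith)
  have h9 : ((2 : ℝ) ^ k - 1) * Real.logb q (C N) ≤ 1 := by linarith
  linarith [mul_add ((2 : ℝ) ^ k - 1) (N - Real.logb q Kst.ncard) (Real.logb q (C N))]
end

section
/- Let 𝔽 be a perfect field with algebraic closure 𝔽̄, let T be a k-tensor over 𝔽 (k ≥ 2), and let T̃ be its slicing along the last axis, viewed as a polynomial map 𝔽̄^N → 𝔽̄^{n_k} with N = n_1 + ⋯ + n_{k−1}. Let X ⊆ ker T̃ ⊆ 𝔽̄^N be an irreducible variety defined over 𝔽 which has an 𝔽-rational point x₀ ∈ X ∩ 𝔽^N that is neither singular on X (i.e., dim T_{x₀}X = dim X) nor DT̃-singular (i.e., rank DT̃(x₀) = max_{x ∈ X} rank DT̃(x), where DT̃(x) is the n_k × N Jacobian matrix of the coordinate polynomials of T̃ evaluated at x). Then PR(T) ≤ (2^{k−1} − 1)·codim X, where PR(T) is the partition rank of T over 𝔽 and codim X = N − dim X. -/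
/-- The `j`-th coordinate of the slicing of the `(k+1)`-tensor `T` along the last axis. -/
noncomputable def sliceP {k : ℕ} {d : Fin (k+1) → ℕ} {F : Type*} [CommRing F]
    (T : ((i : Fin (k+1)) → Fin (d i)) → F) (j : Fin (d (Fin.last k))) :
    MvPolynomial ((i : Fin k) × Fin (d i.castSucc)) F :=
  ∑ I : (i : Fin k) → Fin (d i.castSucc),
    MvPolynomial.C (T (Fin.snoc I j)) * ∏ i : Fin k, MvPolynomial.X ⟨i, I i⟩

/-- `V` is a Zariski-closed set. -/
def IsZeroLocus (K : Type*) [CommRing K] {ι : Type*} (V : Set (ι → K)) : Prop :=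
  ∃ s : Set (MvPolynomial ι K), V = {x | ∀ p ∈ s, MvPolynomial.eval x p = 0}

/-- `V ⊆ K^ι` is cut out by polynomials with coefficients in `F`. -/
def IsZeroLocusOver (F K : Type*) [CommRing F] [CommRing K] [Algebra F K]
    {ι : Type*} (V : Set (ι → K)) : Prop :=
  ∃ s : Set (MvPolynomial ι F), V = {x | ∀ p ∈ s, MvPolynomial.aeval x p = 0}

/-- `V` is an irreducible variety. -/
def IsIrredVariety (K : Type*) [CommRing K] {ι : Type*} (V : Set (ι → K)) : Prop :=
  IsZeroLocus K V ∧ V.Nonempty ∧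
    ∀ V₁ V₂ : Set (ι → K), IsZeroLocus K V₁ → IsZeroLocus K V₂ →
      V = V₁ ∪ V₂ → V = V₁ ∨ V = V₂

/-- The vanishing ideal of a set `V ⊆ K^ι`. -/
def vanishingIdeal (K : Type*) [CommRing K] {ι : Type*} (V : Set (ι → K)) :
    Ideal (MvPolynomial ι K) where
  carrier := {p | ∀ x ∈ V, MvPolynomial.eval x p = 0}
  add_mem' := by
    intro a b ha hb x hx
    simp [ha x hx, hb x hx]
  zero_mem' := by
    intro x hx
    simp
  smul_mem' := by
    intro c p hp x hx
    simp [smul_eq_mul, hp x hx]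

/-- The dimension of a variety: the Krull dimension of its coordinate ring. -/
noncomputable def varDim (K : Type*) [CommRing K] {ι : Type*} (V : Set (ι → K)) :
    WithBot (WithTop ℕ) :=
  ringKrullDim (MvPolynomial ι K ⧸ vanishingIdeal K V)

/-- The tangent space of `V` at `x`. -/
def tangentSpace (K : Type*) [Field K] {ι : Type*} [Fintype ι]
    (V : Set (ι → K)) (x : ι → K) : Submodule K (ι → K) where
  carrier := {v | ∀ p ∈ vanishingIdeal K V,
    ∑ j, MvPolynomial.eval x (MvPolynomial.pderiv j p) * v j = 0}
  add_mem' := by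
    intro v w hv hw p hp
    have h1 := hv p hp
    have h2 := hw p hp
    have key : ∑ j, MvPolynomial.eval x (MvPolynomial.pderiv j p) * (v + w) j
        = (∑ j, MvPolynomial.eval x (MvPolynomial.pderiv j p) * v j)
          + ∑ j, MvPolynomial.eval x (MvPolynomial.pderiv j p) * w j := by
      rw [← Finset.sum_add_distrib]
      exact Finset.sum_congr rfl fun j _ => by simp [mul_add]
    simp only [key, h1, h2, add_zero]
  zero_mem' := by
    intro p hp
    simp
  smul_mem' := by
    intro c v hv p hp
    have h := hv p hp
    have key : ∑ j, MvPolynomial.eval x (MvPolynomial.pderiv j p) * (c • v) j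
        = c * ∑ j, MvPolynomial.eval x (MvPolynomial.pderiv j p) * v j := by
      rw [Finset.mul_sum]
      exact Finset.sum_congr rfl fun j _ => by
        simp only [Pi.smul_apply, smul_eq_mul]; ring
    simp only [key, h, mul_zero]

/-- `x` is a non-singular point of the irreducible variety `V`. -/
def IsNonsingularPoint (K : Type*) [Field K] {ι : Type*} [Fintype ι]
    (V : Set (ι → K)) (x : ι → K) : Prop :=
  x ∈ V ∧ ((Module.finrank K ↥(tangentSpace K V x) : ℕ) : WithBot (WithTop ℕ)) = varDim K V

open MvPolynomial in
theorem aux_taylor_s2 {F ι A : Type*} [Field F] [Fintype ι] [CommRing A] [Algebra F A]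
    (y w : ι → A) (hw : ∀ s s', w s * w s' = 0) (p : MvPolynomial ι F) :
    aeval (y + w) p = aeval y p + ∑ s, aeval y (pderiv s p) * w s := by
  classical
  induction p using MvPolynomial.induction_on with
  | C a => simp
  | add p q hp hq =>
    simp only [map_add, hp, hq, add_mul, Finset.sum_add_distrib]; ring
  | mul_X p s hp =>
    have h1 : (∑ s, aeval y (pderiv s p) * w s) * w s = 0 := by
      rw [Finset.sum_mul]
      exact Finset.sum_eq_zero fun i _ => by rw [mul_assoc, hw, mul_zero]
    have h2 : ∑ i, aeval y (pderiv i (p * X s)) * w i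
        = aeval y p * w s + (∑ s, aeval y (pderiv s p) * w s) * y s := by
      simp only [Derivation.leibniz, pderiv_X, smul_eq_mul, map_add, map_mul, aeval_X, add_mul,
        Finset.sum_add_distrib, Finset.sum_mul]
      congr 1
      · rw [Finset.sum_eq_single s]
        · simp
        · intro b _ hb; simp [Ne.symm hb]
        · simp
      · exact Finset.sum_congr rfl fun i _ => by ring
    rw [h2, map_mul, map_mul, hp, aeval_X, aeval_X, Pi.add_apply]
    linear_combination h1

open MvPolynomial Pointwise in
theorem aux_step {F ι A : Type*} [Field F] [Fintype ι] [DecidableEq ι] [CommRing A] [Algebra F A]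
    {c : ℕ} (P : Ideal (MvPolynomial ι F)) (g : Fin c → MvPolynomial ι F) (J : Fin c → ι)
    (hstar : ∀ p ∈ P, ∃ a : Fin c → MvPolynomial ι F, ∀ s,
      (Matrix.of fun i j => pderiv (J j) (g i)).det * pderiv s p - ∑ i, a i * pderiv s (g i) ∈ P)
    (y : ι → A) (hy : ∀ p ∈ P, aeval y p = 0)
    (hu : IsUnit (aeval y (Matrix.of fun i j => pderiv (J j) (g i)).det))
    (w : ι → A) (hw : ∀ s s', w s * w s' = 0) :
    ∃ a : Fin c → A, (∀ j, a j ∈ Ideal.span (Set.range w)) ∧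
      ∀ p ∈ P, aeval (y + (w + ∑ j, Pi.single (J j) (a j))) p = 0 := by
  set M : Matrix (Fin c) (Fin c) A := Matrix.of fun i j => aeval y (pderiv (J j) (g i)) with hM
  have hdet : IsUnit M.det := by
    convert hu
    rw [AlgHom.map_det]; rfl
  set b : Fin c → A := fun i => ∑ s, aeval y (pderiv s (g i)) * w s with hb
  set a : Fin c → A := - (M⁻¹.mulVec b) with ha
  have hbm : ∀ i, b i ∈ Ideal.span (Set.range w) := fun i =>
    Ideal.sum_mem _ fun s _ => Ideal.mul_mem_left _ _ (Ideal.subset_span ⟨s, rfl⟩)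
  have ham : ∀ j, a j ∈ Ideal.span (Set.range w) := fun j => by
    simp only [ha, Pi.neg_apply, Matrix.mulVec, dotProduct]
    exact neg_mem (Ideal.sum_mem _ fun s _ => Ideal.mul_mem_left _ _ (hbm s))
  refine ⟨a, ham, fun p hp => ?_⟩
  set w' : ι → A := w + ∑ j, Pi.single (J j) (a j) with hw'
  have hw'm : ∀ s, w' s ∈ Ideal.span (Set.range w) := fun s => by
    simp only [hw', Pi.add_apply, Finset.sum_apply]
    refine add_mem (Ideal.subset_span ⟨s, rfl⟩) (Ideal.sum_mem _ fun j _ => ?_)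
    by_cases h : s = J j
    · subst h; simpa using ham j
    · simp [h]
  have hsq : ∀ x ∈ Ideal.span (Set.range w), ∀ z ∈ Ideal.span (Set.range w), x * z = 0 := by
    intro x hx z hz
    have := Ideal.mul_mem_mul hx hz
    rw [Ideal.span_mul_span'] at this
    have h0 : Set.range w * Set.range w ⊆ {0} := by
      rintro _ ⟨_, ⟨s, rfl⟩, _, ⟨s', rfl⟩, rfl⟩; exact hw s s'
    have := Ideal.span_mono h0 this
    simpa using this
  rw [aux_taylor_s2 y w' (fun s s' => hsq _ (hw'm s) _ (hw'm s')), hy p hp, zero_add]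
  have hlin : ∀ q : MvPolynomial ι F, ∑ s, aeval y (pderiv s q) * w' s
      = ∑ s, aeval y (pderiv s q) * w s + ∑ j, aeval y (pderiv (J j) q) * a j := by
    intro q
    simp only [hw', Pi.add_apply, Finset.sum_apply, mul_add, Finset.sum_add_distrib, Finset.mul_sum]
    congr 1
    rw [Finset.sum_comm]
    refine Finset.sum_congr rfl fun j _ => ?_
    rw [Finset.sum_eq_single (J j)]
    · simp
    · intro s _ hs; simp [hs]
    · simp
  have hgz : ∀ i, ∑ s, aeval y (pderiv s (g i)) * w' s = 0 := by
    intro i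
    rw [hlin]
    have : M.mulVec a = - b := by
      rw [ha, Matrix.mulVec_neg, Matrix.mulVec_mulVec, Matrix.mul_nonsing_inv _ hdet,
        Matrix.one_mulVec]
    have := congrFun this i
    simp only [Matrix.mulVec, dotProduct, hM, Matrix.of_apply, Pi.neg_apply] at this
    rw [this]; simp [hb]
  obtain ⟨α, hα⟩ := hstar p hp
  apply hu.mul_left_cancel
  rw [mul_zero, Finset.mul_sum]
  have : ∀ s, aeval y (Matrix.of fun i j => pderiv (J j) (g i)).det * (aeval y (pderiv s p) * w' s)
      = ∑ i, aeval y (α i) * (aeval y (pderiv s (g i)) * w' s) := by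
    intro s
    have := hy _ (hα s)
    rw [map_sub, map_mul, map_sum, sub_eq_zero] at this
    rw [← mul_assoc, this, Finset.sum_mul]
    exact Finset.sum_congr rfl fun i _ => by rw [map_mul, mul_assoc]
  rw [Finset.sum_congr rfl fun s _ => this s, Finset.sum_comm]
  exact Finset.sum_eq_zero fun i _ => by rw [← Finset.mul_sum, hgz, mul_zero]

open MvPolynomial in
theorem aux_aeval_congr {F ι A : Type*} [Field F] [CommRing A] [Algebra F A]
    (I : Ideal A) (y z : ι → A) (h : ∀ s, y s - z s ∈ I) (p : MvPolynomial ι F) :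
    aeval y p - aeval z p ∈ I := by
  rw [← Ideal.Quotient.mk_eq_mk_iff_sub_mem]
  have : (Ideal.Quotient.mkₐ F I).comp (aeval y) = (Ideal.Quotient.mkₐ F I).comp (aeval z) := by
    ext s
    simpa using (Ideal.Quotient.mk_eq_mk_iff_sub_mem _ _).2 (h s)
  exact DFunLike.congr_fun this p

open MvPolynomial in
theorem aux_jets_s2 {F A : Type*} [Field F] {k : ℕ} {β : Fin k → Type*} [∀ i, Fintype (β i)]
    [DecidableEq ((i : Fin k) × β i)] [CommRing A] [Algebra F A]
    {c : ℕ} (P : Ideal (MvPolynomial ((i : Fin k) × β i) F))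
    (g : Fin c → MvPolynomial ((i : Fin k) × β i) F) (J : Fin c → (i : Fin k) × β i)
    (hstar : ∀ p ∈ P, ∃ a : Fin c → MvPolynomial ((i : Fin k) × β i) F, ∀ s,
      (Matrix.of fun i j => pderiv (J j) (g i)).det * pderiv s p - ∑ i, a i * pderiv s (g i) ∈ P)
    (x₀ : ((i : Fin k) × β i) → F) (hx₀ : ∀ p ∈ P, eval x₀ p = 0)
    (hΔ : eval x₀ (Matrix.of fun i j => pderiv (J j) (g i)).det ≠ 0)
    (v : ((i : Fin k) × β i) → A) (hv : ∀ s s', s.1 = s'.1 → v s * v s' = 0) :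
    ∃ a : Fin c → A, (∀ j, a j ∈ Ideal.span (Set.range v)) ∧
      ∀ p ∈ P, aeval (fun s => algebraMap F A (x₀ s) + v s
        + (∑ j, Pi.single (J j) (a j) : ((i : Fin k) × β i) → A) s) p = 0 := by
  have key : ∀ m : ℕ, ∃ a : Fin c → A, (∀ j, a j ∈ Ideal.span (Set.range v)) ∧
      ∀ p ∈ P, aeval (fun s => algebraMap F A (x₀ s) + (if s.1.1 < m then v s else 0)
        + (∑ j, Pi.single (J j) (a j) : ((i : Fin k) × β i) → A) s) p = 0 := by
    intro m
    induction m with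
    | zero =>
      refine ⟨0, fun j => zero_mem _, fun p hp => ?_⟩
      have : (fun s => algebraMap F A (x₀ s) + (if s.1.1 < 0 then v s else 0)
        + (∑ j, Pi.single (J j) ((0 : Fin c → A) j) : ((i : Fin k) × β i) → A) s)
          = fun s => algebraMap F A (x₀ s) := by
        ext s; simp
      rw [this]
      have h2 := aeval_algebraMap_apply A x₀ p
      rw [show (fun s => algebraMap F A (x₀ s)) = algebraMap F A ∘ x₀ from rfl, h2]
      have : aeval x₀ p = eval x₀ p := by simp [aeval_eq_eval]
      rw [this, hx₀ p hp, map_zero]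
    | succ m ih =>
      obtain ⟨a, ha, hP⟩ := ih
      set y : ((i : Fin k) × β i) → A := (fun s => algebraMap F A (x₀ s)
        + (if s.1.1 < m then v s else 0)
        + (∑ j, Pi.single (J j) (a j) : ((i : Fin k) × β i) → A) s) with hy
      have hu : IsUnit (aeval y (Matrix.of fun i j => pderiv (J j) (g i)).det) := by
        set D := (Matrix.of fun i j => pderiv (J j) (g i)).det
        have h1 := aux_aeval_congr (Ideal.span (Set.range v)) y (algebraMap F A ∘ x₀) (by
          intro s
          have : y s - (algebraMap F A ∘ x₀) s = (if s.1.1 < m then v s else 0)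
            + (∑ j, Pi.single (J j) (a j) : ((i : Fin k) × β i) → A) s := by
              simp only [hy, Function.comp]; ring
          rw [this]
          refine Ideal.add_mem (Ideal.span (Set.range v)) ?_ ?_
          · split_ifs
            · exact Ideal.subset_span ⟨s, rfl⟩
            · exact zero_mem _
          · rw [Finset.sum_apply]
            refine Ideal.sum_mem _ fun j _ => ?_
            by_cases h : s = J j
            · subst h; simpa using ha j
            · simp [h]) D
        have hnil : Ideal.span (Set.range v) ≤ nilradical A := by
          rw [Ideal.span_le]
          rintro _ ⟨s, rfl⟩
          have h2 : IsNilpotent (v s) := ⟨2, by rw [pow_two, hv s s rfl]⟩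
          exact h2
        have h2 : IsNilpotent (aeval y D - aeval (algebraMap F A ∘ x₀) D) := hnil h1
        have h3 : IsUnit (aeval (algebraMap F A ∘ x₀) D) := by
          rw [aeval_algebraMap_apply]
          have : aeval x₀ D = eval x₀ D := by simp [aeval_eq_eval]
          rw [this]
          exact (IsUnit.mk0 _ hΔ).map _
        have := h2.isUnit_add_left_of_commute h3 (Commute.all _ _)
        simpa using this
      obtain ⟨a', ha', hP'⟩ := aux_step P g J hstar y hP hu
        (fun s => if s.1.1 = m then v s else 0) (by
          intro s s'
          by_cases h : s.1.1 = m
          · by_cases h' : s'.1.1 = m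
            · simp only [h, h', if_true]
              exact hv s s' (Fin.ext (h.trans h'.symm))
            · simp [h']
          · simp [h])
      refine ⟨a + a', fun j => add_mem (ha j) ?_, fun p hp => ?_⟩
      · refine (Ideal.span_le.2 ?_) (ha' j)
        rintro _ ⟨s, rfl⟩
        dsimp only
        split_ifs
        · exact Ideal.subset_span ⟨s, rfl⟩
        · exact zero_mem _
      · refine Eq.trans ?_ (hP' p hp)
        apply congrArg (fun z => aeval z p)
        ext s
        simp only [hy, Pi.add_apply, Finset.sum_apply, Pi.single_add, Finset.sum_add_distrib]
        have : (if s.1.1 < m + 1 then v s else 0)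
            = (if s.1.1 < m then v s else 0) + (if s.1.1 = m then v s else 0) := by
          rcases lt_trichotomy s.1.1 m with h | h | h
          · rw [if_pos (by omega), if_pos h, if_neg (by omega), add_zero]
          · rw [if_pos (by omega), if_neg (by omega), if_pos h, zero_add]
          · rw [if_neg (by omega), if_neg (by omega), if_neg (by omega), add_zero]
        rw [this]; ring
  obtain ⟨a, ha, h⟩ := key k
  refine ⟨a, ha, fun p hp => ?_⟩
  refine Eq.trans ?_ (h p hp)
  apply congrArg (fun z => aeval z p)
  ext s
  rw [if_pos s.1.2]

theorem aux_hasPR_of_fintype {ι : Type*} {β : ι → Type*} {F : Type*} [CommRing F]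
    (T : ((i : ι) → β i) → F) {κ : Type*} [Fintype κ]
    (S : κ → Set ι) (p q : κ → ((i : ι) → β i) → F)
    (h : ∀ j, (S j).Nonempty ∧ S j ≠ Set.univ ∧
      DependsOnlyOn (p j) (S j) ∧ DependsOnlyOn (q j) (S j)ᶜ)
    (hT : ∀ I, T I = ∑ j, p j I * q j I) : HasPRDecomp T (Fintype.card κ) := by
  let e := (Fintype.equivFin κ).symm
  refine ⟨S ∘ e, p ∘ e, q ∘ e, fun j => h (e j), fun I => ?_⟩
  rw [hT I]
  exact (Equiv.sum_comp e (fun j => p j I * q j I)).symm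

/-- The squarefree exponent attached to a multi-index and a set of positions. -/
noncomputable def auxMu {k : ℕ} {β : Fin k → Type*} (I : (i : Fin k) → β i)
    (S : Finset (Fin k)) : ((i : Fin k) × β i) →₀ ℕ :=
  ∑ i ∈ S, Finsupp.single (⟨i, I i⟩ : (i : Fin k) × β i) 1

open Classical in
theorem auxMu_apply {k : ℕ} {β : Fin k → Type*} (I : (i : Fin k) → β i)
    (S : Finset (Fin k)) (s : (i : Fin k) × β i) :
    auxMu I S s = if s.1 ∈ S ∧ s.2 = I s.1 then 1 else 0 := by
  obtain ⟨i, b⟩ := s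
  rw [auxMu, Finsupp.finsetSum_apply]
  by_cases h : i ∈ S ∧ b = I i
  · rw [if_pos h, Finset.sum_eq_single i]
    · rw [h.2]; simp
    · intro j _ hj
      rw [Finsupp.single_apply, if_neg]
      intro h'
      exact hj (Sigma.mk.inj_iff.1 h').1
    · intro h'; exact absurd h.1 h'
  · rw [if_neg h]
    refine Finset.sum_eq_zero fun j hj => ?_
    rw [Finsupp.single_apply, if_neg]
    intro h'
    obtain ⟨rfl, h2⟩ := Sigma.mk.inj_iff.1 h'
    exact h ⟨hj, (eq_of_heq h2).symm⟩

theorem auxMu_self {k : ℕ} {β : Fin k → Type*} (I : (i : Fin k) → β i)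
    (S : Finset (Fin k)) (i : Fin k) : auxMu I S ⟨i, I i⟩ = if i ∈ S then 1 else 0 := by
  classical
  rw [auxMu_apply]; simp

open MvPolynomial in
theorem aux_coeff_N {k : ℕ} {β : Fin k → Type*} {F : Type*} [Field F]
    (I : (i : Fin k) → β i) (p : MvPolynomial ((i : Fin k) × β i) F)
    (hp : p ∈ Ideal.span {q : MvPolynomial ((i : Fin k) × β i) F |
      ∃ s s', s.1 = s'.1 ∧ q = X s * X s'}) :
    coeff (auxMu I Finset.univ) p = 0 := by
  classical
  have key : ∀ r : MvPolynomial ((i : Fin k) × β i) F,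
      coeff (auxMu I Finset.univ) (r * p) = 0 := by
    induction hp using Submodule.span_induction with
    | zero => simp
    | add x y _ _ hx hy => intro r; simp [mul_add, hx, hy]
    | smul a x _ hx => intro r; rw [smul_eq_mul, ← mul_assoc]; exact hx _
    | mem x hx =>
      intro r
      obtain ⟨s, s', hss, rfl⟩ := hx
      rw [← mul_assoc, coeff_mul_X']
      split_ifs with h1
      · rw [coeff_mul_X']
        split_ifs with h2
        · exfalso
          rw [Finsupp.mem_support_iff] at h1 h2
          obtain ⟨i, b⟩ := s
          obtain ⟨i', b'⟩ := s'
          obtain rfl : i = i' := hss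
          have hb' : b' = I i := by
            by_contra hne
            exact h1 (by rw [auxMu_apply]; simp [hne])
          by_cases hb : b = I i
          · subst hb' hb
            apply h2
            simp [auxMu_self]
          · apply h2
            simp [auxMu_apply, hb]
        · rfl
      · rfl
  simpa using key 1

theorem aux_coeff_mul {k : ℕ} {β : Fin k → Type*} {F : Type*} [Field F]
    (I : (i : Fin k) → β i) (p q : MvPolynomial ((i : Fin k) × β i) F) :
    MvPolynomial.coeff (auxMu I Finset.univ) (p * q)
      = ∑ S : Finset (Fin k), MvPolynomial.coeff (auxMu I S) p * MvPolynomial.coeff (auxMu I Sᶜ) q := by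
  classical
  rw [MvPolynomial.coeff_mul]
  symm
  refine Finset.sum_bij (fun S _ => (auxMu I S, auxMu I Sᶜ)) ?_ ?_ ?_ ?_
  · intro S _
    rw [Finset.HasAntidiagonal.mem_antidiagonal]
    ext s
    simp only [Finsupp.add_apply, auxMu_apply, Finset.mem_compl, Finset.mem_univ, true_and]
    by_cases h1 : s.1 ∈ S <;> by_cases h2 : s.2 = I s.1 <;> simp [h1, h2]
  · intro S _ S' _ h
    ext i
    have := DFunLike.congr_fun (Prod.mk.inj h).1 ⟨i, I i⟩
    simp only [auxMu_self] at this
    by_cases h1 : i ∈ S <;> by_cases h2 : i ∈ S' <;> simp_all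
  · rintro ⟨m1, m2⟩ hm
    rw [Finset.HasAntidiagonal.mem_antidiagonal] at hm
    have hm' : ∀ s, m1 s + m2 s = if s.2 = I s.1 then 1 else 0 := fun s => by
      have := DFunLike.congr_fun hm s
      simpa [auxMu_apply] using this
    refine ⟨Finset.univ.filter fun i => m1 ⟨i, I i⟩ = 1, Finset.mem_univ _, ?_⟩
    ext s
    all_goals
      obtain ⟨i, b⟩ := s
      simp only [auxMu_apply, Finset.mem_compl, Finset.mem_filter, Finset.mem_univ, true_and]
      by_cases h2 : b = I i
      · subst h2
        have := hm' ⟨i, I i⟩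
        simp only [if_true] at this
        by_cases h3 : m1 ⟨i, I i⟩ = 1 <;> simp [h3] <;> omega
      · have := hm' ⟨i, b⟩
        simp only [h2, if_false] at this
        simp only [h2, and_false, if_false]
        omega
  · intro S _; rfl

open MvPolynomial in
theorem aux_coeff_slice {k : ℕ} {d : Fin (k+1) → ℕ} {F : Type*} [Field F]
    (T : ((i : Fin (k+1)) → Fin (d i)) → F) (j : Fin (d (Fin.last k)))
    (x₀ : ((i : Fin k) × Fin (d i.castSucc)) → F) (I : (i : Fin k) → Fin (d i.castSucc)) :
    coeff (auxMu I Finset.univ)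
      (aeval (fun s => (C (x₀ s) + X s : MvPolynomial ((i : Fin k) × Fin (d i.castSucc)) F))
        (sliceP T j)) = T (Fin.snoc I j) := by
  classical
  have hprod : ∀ I' : (i : Fin k) → Fin (d i.castSucc),
      coeff (auxMu I Finset.univ) (∏ i : Fin k,
        (C (x₀ ⟨i, I' i⟩) + X ⟨i, I' i⟩ : MvPolynomial ((i : Fin k) × Fin (d i.castSucc)) F))
      = if I' = I then 1 else 0 := by
    intro I'
    rw [Finset.prod_add, coeff_sum]
    have hm : ∀ t : Finset (Fin k), (∏ i ∈ t, C (x₀ ⟨i, I' i⟩)) *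
        ∏ i ∈ Finset.univ \ t, (X ⟨i, I' i⟩ : MvPolynomial ((i : Fin k) × Fin (d i.castSucc)) F)
        = monomial (auxMu I' (Finset.univ \ t)) (∏ i ∈ t, x₀ ⟨i, I' i⟩) := by
      intro t
      have h1 : ∀ u : Finset (Fin k), ∏ i ∈ u,
          (X ⟨i, I' i⟩ : MvPolynomial ((i : Fin k) × Fin (d i.castSucc)) F)
          = monomial (auxMu I' u) 1 := by
        intro u
        rw [auxMu, monomial_sum_one]
        rfl
      rw [← map_prod, h1, C_mul_monomial, mul_one]
    simp only [hm, coeff_monomial]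
    split_ifs with h
    · subst h
      rw [Finset.sum_eq_single ∅]
      · simp
      · intro t _ ht
        rw [if_neg]
        intro h'
        obtain ⟨i, hi⟩ := Finset.nonempty_iff_ne_empty.2 ht
        have := DFunLike.congr_fun h' ⟨i, I' i⟩
        simp [auxMu_self, hi] at this
      · simp
    · refine Finset.sum_eq_zero fun t _ => ?_
      rw [if_neg]
      intro h'
      apply h
      ext i : 1
      have := DFunLike.congr_fun h' ⟨i, I i⟩
      simp only [auxMu_apply, Finset.mem_univ, true_and, if_true] at this
      by_contra hne
      rw [if_neg (fun h => hne h.2.symm)] at this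
      exact absurd this (by norm_num)
  simp only [sliceP, map_sum, map_mul, map_prod, aeval_X, aeval_C, algebraMap_eq, coeff_sum,
    coeff_C_mul, hprod]
  simp

open MvPolynomial in
theorem aux_pr {k : ℕ} {d : Fin (k+1) → ℕ} {F : Type*} [Field F]
    (T : ((i : Fin (k+1)) → Fin (d i)) → F) {c : ℕ}
    (x₀ : ((i : Fin k) × Fin (d i.castSucc)) → F)
    (a : Fin c → MvPolynomial ((i : Fin k) × Fin (d i.castSucc)) F)
    (ha : ∀ j, coeff 0 (a j) = 0)
    (J : Fin c → (i : Fin k) × Fin (d i.castSucc))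
    (hN : ∀ j, aeval (fun s => C (x₀ s) + X s + (∑ l, Pi.single (J l) (a l) :
        ((i : Fin k) × Fin (d i.castSucc)) → MvPolynomial ((i : Fin k) × Fin (d i.castSucc)) F) s)
        (sliceP T j) ∈ Ideal.span {q : MvPolynomial ((i : Fin k) × Fin (d i.castSucc)) F |
      ∃ s s', s.1 = s'.1 ∧ q = X s * X s'}) :
    partitionRank T ≤ (2 ^ k - 1) * c := by
  classical
  have hb : ∀ j, ∃ b : Fin c → MvPolynomial ((i : Fin k) × Fin (d i.castSucc)) F,
      ∑ l, b l * a l = aeval (fun s => C (x₀ s) + X s + (∑ l, Pi.single (J l) (a l) :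
        ((i : Fin k) × Fin (d i.castSucc)) → MvPolynomial ((i : Fin k) × Fin (d i.castSucc)) F) s)
        (sliceP T j) - aeval (fun s => C (x₀ s) + X s) (sliceP T j) := by
    intro j
    rw [← Ideal.mem_span_range_iff_exists_fun]
    refine aux_aeval_congr _ _ _ (fun s => ?_) _
    rw [add_sub_cancel_left, Finset.sum_apply]
    refine Ideal.sum_mem _ fun l _ => ?_
    by_cases h : s = J l
    · subst h; simpa using Ideal.subset_span (Set.mem_range_self l)
    · simp [h]
  choose b hb using hb
  have hcard : Fintype.card (Fin c × {S : Finset (Fin k) // S.Nonempty}) = (2 ^ k - 1) * c := by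
    rw [Fintype.card_prod, Fintype.card_fin, mul_comm]
    congr 1
    have : Fintype.card {S : Finset (Fin k) // S.Nonempty}
        = Fintype.card {S : Finset (Fin k) // ¬ S = ∅} :=
      Fintype.card_congr (Equiv.subtypeEquivRight fun S => Finset.nonempty_iff_ne_empty)
    rw [this, Fintype.card_subtype_compl]
    simp
  rw [← hcard]
  refine Nat.sInf_le ?_
  refine aux_hasPR_of_fintype T (fun l => Fin.castSucc '' (l.2.1 : Set (Fin k)))
    (fun l I => coeff (auxMu (fun i => I i.castSucc) l.2.1) (a l.1))
    (fun l I => - coeff (auxMu (fun i => I i.castSucc) l.2.1ᶜ) (b (I (Fin.last k)) l.1)) ?_ ?_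
  · rintro ⟨l, S, hS⟩
    refine ⟨Set.Nonempty.image _ (Finset.coe_nonempty.2 hS), ?_, ?_, ?_⟩
    · intro h
      have : Fin.last k ∈ Fin.castSucc '' (S : Set (Fin k)) := by
        simp only at h
        rw [h]; trivial
      obtain ⟨i, _, hi⟩ := this
      exact (Fin.castSucc_lt_last i).ne hi
    · intro x y hxy
      have : auxMu (fun i => x (Fin.castSucc i)) S = auxMu (fun i => y (Fin.castSucc i)) S := by
        refine Finset.sum_congr rfl fun i hi => ?_
        simp only [hxy _ ⟨i, hi, rfl⟩]
      simp only [this]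
    · intro x y hxy
      have : auxMu (fun i => x (Fin.castSucc i)) Sᶜ = auxMu (fun i => y (Fin.castSucc i)) Sᶜ := by
        refine Finset.sum_congr rfl fun i hi => ?_
        have h3 : x (Fin.castSucc i) = y (Fin.castSucc i) := by
          apply hxy
          rintro ⟨i', hi', h⟩
          rw [Fin.castSucc_inj] at h
          subst h
          exact (Finset.mem_compl.1 hi) hi'
        simp only [h3]
      have h2 : x (Fin.last k) = y (Fin.last k) := by
        apply hxy
        rintro ⟨i', hi', h⟩
        exact (Fin.castSucc_lt_last i').ne h
      simp only [this, h2]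
  · intro I
    have h1 := congrArg (coeff (auxMu (fun i => I (Fin.castSucc i)) Finset.univ))
      (hb (I (Fin.last k)))
    rw [coeff_sub, aux_coeff_slice, aux_coeff_N _ _ (hN _), zero_sub, coeff_sum] at h1
    have hI : (Fin.snoc (fun i => I (Fin.castSucc i)) (I (Fin.last k)) :
        (i : Fin (k+1)) → Fin (d i)) = I := Fin.snoc_init_self I
    rw [hI] at h1
    rw [← neg_eq_iff_eq_neg.2 h1.symm.symm, Fintype.sum_prod_type, ← Finset.sum_neg_distrib]
    refine Finset.sum_congr rfl fun l _ => ?_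
    rw [mul_comm, aux_coeff_mul, ← Finset.sum_neg_distrib,
      ← Fintype.sum_subtype_add_sum_subtype (fun S : Finset (Fin k) => S.Nonempty)]
    rw [Fintype.sum_eq_zero (fun S : {S : Finset (Fin k) // ¬ S.Nonempty} => _), add_zero]
    · simp
    · rintro ⟨S, hS⟩
      rw [Finset.not_nonempty_iff_eq_empty] at hS
      subst hS
      simp [auxMu, ha]

theorem aux_krull_le {K A L : Type} [Field K] [CommRing A] [IsDomain A] [Algebra K A]
    [Algebra.FiniteType K A] [Field L] [Algebra A L] [IsFractionRing A L] [Algebra K L]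
    [IsScalarTower K A L] {ι : Type} [Fintype ι] {v : ι → L} (hv : IsTranscendenceBasis K v) :
    ringKrullDim A ≤ (Fintype.card ι : ℕ) := by
  obtain ⟨s, g, hinj, hint⟩ := exists_integral_inj_algHom_of_fg K A
  have h1 : ringKrullDim A ≤ ringKrullDim (MvPolynomial (Fin s) K) := by
    let _ := g.toRingHom.toAlgebra
    have : Algebra.IsIntegral (MvPolynomial (Fin s) K) A := ⟨hint⟩
    refine Order.krullDim_le_of_strictMono
      (PrimeSpectrum.comap (algebraMap (MvPolynomial (Fin s) K) A)) ?_
    intro p q hpq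
    exact Ideal.IsIntegral.comap_lt_comap (R := MvPolynomial (Fin s) K) hpq
  refine h1.trans ?_
  rw [MvPolynomial.ringKrullDim_of_isNoetherianRing, ringKrullDim_eq_zero_of_field, zero_add]
  have h2 : AlgebraicIndependent K
      (fun i => algebraMap A L (g (MvPolynomial.X i : MvPolynomial (Fin s) K))) := by
    have e : MvPolynomial.aeval (fun i => algebraMap A L (g (MvPolynomial.X i : MvPolynomial (Fin s) K)))
        = (IsScalarTower.toAlgHom K A L).comp g := by
      ext i; simp
    rw [AlgebraicIndependent, e]
    exact (IsFractionRing.injective A L).comp hinj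
  have h3 := h2.cardinalMk_le_trdeg
  rw [← hv.cardinalMk_eq_trdeg] at h3
  simp only [Cardinal.mk_fintype, Nat.cast_le] at h3
  simpa using h3

open scoped IntermediateField.algebraAdjoinAdjoin KaehlerDifferential TensorProduct in
theorem aux_omega {K L : Type} [Field K] [Field L] [Algebra K L] {ι : Type} [Fintype ι]
    {v : ι → L} (hv : AlgebraicIndependent K v)
    [Algebra.IsSeparable (IntermediateField.adjoin K (Set.range v)) L] :
    Module.finrank L Ω[L⁄K] = Fintype.card ι := by
  let B := Algebra.adjoin K (Set.range v)
  let E := MvPolynomial ι K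
  let _ : Algebra E L := (MvPolynomial.aeval v : E →ₐ[K] L).toRingHom.toAlgebra
  let _ : Algebra E B := hv.aevalEquiv.toAlgHom.toRingHom.toAlgebra
  have : IsScalarTower K E L := IsScalarTower.of_algebraMap_eq' 
    (MvPolynomial.aeval v : E →ₐ[K] L).comp_algebraMap.symm
  have : IsScalarTower E B L := IsScalarTower.of_algebraMap_eq fun x => by
    exact (hv.algebraMap_aevalEquiv x).symm
  have : Algebra.FormallyEtale B (IntermediateField.adjoin K (Set.range v)) :=
    .of_isLocalization (nonZeroDivisors _)
  have : Algebra.FormallyEtale (IntermediateField.adjoin K (Set.range v)) L :=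
    .of_isSeparable _ _
  have : Algebra.FormallyEtale B L := .comp _ (IntermediateField.adjoin K (Set.range v)) _
  have : Algebra.FormallyEtale E B := by
    let e : E ≃ₐ[E] B := { hv.aevalEquiv.toRingEquiv with commutes' := fun r => rfl }
    exact .of_equiv e
  have : Algebra.FormallyEtale E L := .comp _ B _
  let b := (KaehlerDifferential.mvPolynomialBasis K ι).baseChange L
  rw [← (KaehlerDifferential.tensorKaehlerEquivOfFormallyEtale K E L).finrank_eq]
  exact Module.finrank_eq_card_basis b

open KaehlerDifferential in
theorem aux_chain {K L σ : Type} [Field K] [Field L] [Algebra K L] [Fintype σ]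
    (φ : MvPolynomial σ K →ₐ[K] L) (p : MvPolynomial σ K) :
    D K L (φ p) = ∑ s, φ (MvPolynomial.pderiv s p) • D K L (φ (MvPolynomial.X s)) := by
  classical
  induction p using MvPolynomial.induction_on with
  | C a =>
    have : φ (MvPolynomial.C a) = algebraMap K L a := φ.commutes a
    simp [this]
  | add p q hp hq => simp [hp, hq, add_smul, Finset.sum_add_distrib]
  | mul_X p i hp =>
    rw [map_mul, Derivation.leibniz, hp, Finset.smul_sum]
    have : ∀ s, φ (MvPolynomial.pderiv s (p * MvPolynomial.X i)) • D K L (φ (MvPolynomial.X s))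
      = (if s = i then φ p • D K L (φ (MvPolynomial.X s)) else 0)
        + φ (MvPolynomial.X i) • φ (MvPolynomial.pderiv s p) • D K L (φ (MvPolynomial.X s)) := by
      intro s
      rw [Derivation.leibniz, MvPolynomial.pderiv_X]
      by_cases h : s = i
      · subst h
        simp [add_smul, mul_smul]
      · simp [h, Ne.symm h, mul_smul]
    rw [Finset.sum_congr rfl fun s _ => this s, Finset.sum_add_distrib]
    simp

open KaehlerDifferential in
theorem aux_ker_le {K L σ : Type} [Field K] [PerfectField K] [Field L] [Algebra K L] [Fintype σ]
    (P : Ideal (MvPolynomial σ K)) [P.IsPrime] [Algebra (MvPolynomial σ K ⧸ P) L]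
    [IsFractionRing (MvPolynomial σ K ⧸ P) L] [IsScalarTower K (MvPolynomial σ K ⧸ P) L]
    (c : ℕ) (hc : ringKrullDim (MvPolynomial σ K ⧸ P) + (c : WithBot ℕ∞)
      = ((Fintype.card σ : ℕ) : WithBot ℕ∞)) :
    ∃ W : Submodule L (σ → L), Module.finrank L W ≤ c ∧ ∀ p ∈ P,
      (fun s => algebraMap (MvPolynomial σ K ⧸ P) L
        (Ideal.Quotient.mk P (MvPolynomial.pderiv s p))) ∈ W := by
  classical
  let φ : MvPolynomial σ K →ₐ[K] L :=
    (IsScalarTower.toAlgHom K (MvPolynomial σ K ⧸ P) L).comp (Ideal.Quotient.mkₐ K P)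
  let Φ : (σ → L) →ₗ[L] Ω[L⁄K] := Fintype.linearCombination L (fun s => D K L (φ (MvPolynomial.X s)))
  have hΦ : ∀ p, D K L (φ p) = Φ (fun s => φ (MvPolynomial.pderiv s p)) := by
    intro p
    rw [aux_chain]; rfl
  have hsurj : LinearMap.range Φ = ⊤ := by
    rw [eq_top_iff, ← KaehlerDifferential.span_range_derivation, Submodule.span_le]
    rintro _ ⟨x, rfl⟩
    obtain ⟨a, b, hb, rfl⟩ := IsFractionRing.div_surjective (A := MvPolynomial σ K ⧸ P) x
    obtain ⟨a, rfl⟩ := Ideal.Quotient.mk_surjective a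
    obtain ⟨b, rfl⟩ := Ideal.Quotient.mk_surjective b
    have hb0 : φ b ≠ 0 := by
      have := IsFractionRing.to_map_ne_zero_of_mem_nonZeroDivisors (K := L) hb
      exact this
    change D K L (φ a / φ b) ∈ LinearMap.range Φ
    have h1 : φ b • D K L (φ a / φ b) = D K L (φ a) - (φ a / φ b) • D K L (φ b) := by
      rw [eq_sub_iff_add_eq, ← Derivation.leibniz, mul_div_cancel₀ _ hb0]
    have h2 : D K L (φ a / φ b) = (φ b)⁻¹ • (D K L (φ a) - (φ a / φ b) • D K L (φ b)) := by
      rw [← h1, smul_smul, inv_mul_cancel₀ hb0, one_smul]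
    rw [h2, hΦ, hΦ]
    exact Submodule.smul_mem _ _ (Submodule.sub_mem _ ⟨_, rfl⟩ (Submodule.smul_mem _ _ ⟨_, rfl⟩))
  have : Algebra.EssFiniteType (MvPolynomial σ K ⧸ P) L :=
    Algebra.EssFiniteType.of_isLocalization _ (nonZeroDivisors (MvPolynomial σ K ⧸ P))
  have : Algebra.EssFiniteType K L := Algebra.EssFiniteType.comp K (MvPolynomial σ K ⧸ P) L
  obtain ⟨t, ht, hsep⟩ := exists_isTranscendenceBasis_and_isSeparable_of_perfectField K L
  have : Algebra.IsSeparable (IntermediateField.adjoin K (Set.range ((↑) : t → L))) L := by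
    convert! hsep <;> simp
  have h3 := aux_omega ht.1
  have h4 := aux_krull_le (A := MvPolynomial σ K ⧸ P) ht
  refine ⟨LinearMap.ker Φ, ?_, fun p hp => ?_⟩
  · have h5 := Φ.finrank_range_add_finrank_ker
    rw [hsurj, finrank_top, h3, Module.finrank_fintype_fun_eq_card] at h5
    have h6 : ((Fintype.card σ : ℕ) : WithBot ℕ∞) ≤ ((Fintype.card t + c : ℕ) : WithBot ℕ∞) := by
      rw [← hc]; push_cast
      exact add_le_add_left h4 _
    have h7 : Fintype.card σ ≤ Fintype.card t + c := by exact_mod_cast h6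
    omega
  · rw [LinearMap.mem_ker]
    have := hΦ p
    have h0 : φ p = 0 := by
      change algebraMap (MvPolynomial σ K ⧸ P) L (Ideal.Quotient.mk P p) = 0
      rw [Ideal.Quotient.eq_zero_iff_mem.2 hp, map_zero]
    rw [h0, map_zero] at this
    exact this.symm

theorem aux_generic_aux {K L σ : Type} [Field K] [PerfectField K] [Fintype σ]
    (P : Ideal (MvPolynomial σ K)) [P.IsPrime] [Field L] [Algebra K L] [Algebra (MvPolynomial σ K ⧸ P) L]
    [IsFractionRing (MvPolynomial σ K ⧸ P) L] [IsScalarTower K (MvPolynomial σ K ⧸ P) L]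
    (c : ℕ) (hc : ringKrullDim (MvPolynomial σ K ⧸ P) + (c : WithBot ℕ∞)
      = ((Fintype.card σ : ℕ) : WithBot ℕ∞))
    (g : Fin c → MvPolynomial σ K) (hg : ∀ i, g i ∈ P) (J : Fin c → σ)
    (M : Matrix (Fin c) (Fin c) (MvPolynomial σ K))
    (hM : M = Matrix.of fun i j => MvPolynomial.pderiv (J j) (g i))
    (hdet : M.det ∉ P) (p : MvPolynomial σ K) (hp : p ∈ P) (s : σ) :
    M.det * MvPolynomial.pderiv s p
      - ∑ i, (∑ j, MvPolynomial.pderiv (J j) p * M.adjugate j i) * MvPolynomial.pderiv s (g i) ∈ P := by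
  classical
  let φ : MvPolynomial σ K →+* L :=
    (algebraMap (MvPolynomial σ K ⧸ P) L).comp (Ideal.Quotient.mk P)
  have hφ : ∀ q, φ q = 0 ↔ q ∈ P := by
    intro q
    rw [← Ideal.Quotient.eq_zero_iff_mem]
    exact map_eq_zero_iff _ (IsFractionRing.injective (MvPolynomial σ K ⧸ P) L)
  obtain ⟨W, hW, hPW⟩ := aux_ker_le (L := L) P c hc
  have hdet' : (φ.mapMatrix M).det ≠ 0 := by
    rw [← RingHom.map_det]
    exact fun h => hdet ((hφ _).1 h)
  let w : Fin c → (σ → L) := fun i s => φ (MvPolynomial.pderiv s (g i))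
  have hw : LinearIndependent L w := by
    refine LinearIndependent.of_comp (LinearMap.funLeft L L J) ?_
    have h := Matrix.linearIndependent_rows_of_det_ne_zero hdet'
    have h' : (LinearMap.funLeft L L J) ∘ w = fun i => (φ.mapMatrix M) i := by
      ext i j
      simp [w, hM, LinearMap.funLeft]
    rw [h']
    exact h
  have hspan : Submodule.span L (Set.range w) = W := by
    refine Submodule.eq_of_le_of_finrank_le ?_ ?_
    · rw [Submodule.span_le]
      rintro _ ⟨i, rfl⟩
      exact hPW _ (hg i)
    · rw [finrank_span_eq_card hw, Fintype.card_fin]; exact hW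
  have hpW := hPW p hp
  rw [← hspan, Submodule.mem_span_range_iff_exists_fun] at hpW
  obtain ⟨b, hb⟩ := hpW
  have hb' : ∀ s, φ (MvPolynomial.pderiv s p) = ∑ i, b i * φ (MvPolynomial.pderiv s (g i)) := by
    intro s
    have := congrFun hb s
    simp only [Finset.sum_apply, Pi.smul_apply, smul_eq_mul] at this
    exact this.symm
  have hadj : ∀ i, ∑ j, φ (MvPolynomial.pderiv (J j) p) * φ (M.adjugate j i) = φ M.det * b i := by
    intro i
    have h1 : (fun j => φ (MvPolynomial.pderiv (J j) p)) = Matrix.vecMul b (φ.mapMatrix M) := by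
      ext j
      rw [hb']
      simp [Matrix.vecMul, dotProduct, hM]
    have h2 : Matrix.vecMul (fun j => φ (MvPolynomial.pderiv (J j) p)) (φ.mapMatrix M.adjugate)
        = (φ M.det) • b := by
      rw [h1, Matrix.vecMul_vecMul, RingHom.map_adjugate, Matrix.mul_adjugate,
        Matrix.vecMul_smul, Matrix.vecMul_one, RingHom.map_det]
    have := congrFun h2 i
    simpa [Matrix.vecMul, dotProduct] using this
  rw [← hφ, map_sub, map_mul, map_sum, hb', Finset.mul_sum, sub_eq_zero]
  refine Finset.sum_congr rfl fun i _ => ?_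
  rw [map_mul, map_sum]
  simp only [map_mul, hadj]
  ring

theorem aux_generic_s2 {K σ : Type} [Field K] [PerfectField K] [Fintype σ]
    (P : Ideal (MvPolynomial σ K)) [P.IsPrime]
    (c : ℕ) (hc : ringKrullDim (MvPolynomial σ K ⧸ P) + (c : WithBot ℕ∞)
      = ((Fintype.card σ : ℕ) : WithBot ℕ∞))
    (g : Fin c → MvPolynomial σ K) (hg : ∀ i, g i ∈ P) (J : Fin c → σ)
    (M : Matrix (Fin c) (Fin c) (MvPolynomial σ K))
    (hM : M = Matrix.of fun i j => MvPolynomial.pderiv (J j) (g i))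
    (hdet : M.det ∉ P) (p : MvPolynomial σ K) (hp : p ∈ P) (s : σ) :
    M.det * MvPolynomial.pderiv s p
      - ∑ i, (∑ j, MvPolynomial.pderiv (J j) p * M.adjugate j i) * MvPolynomial.pderiv s (g i) ∈ P := by
  exact aux_generic_aux (L := FractionRing (MvPolynomial σ K ⧸ P)) P c hc g hg J M hM hdet p hp s

theorem aux_prime {K ι : Type} [Field K] (V : Set (ι → K)) (hV : IsIrredVariety K V) :
    (vanishingIdeal K V).IsPrime := by
  obtain ⟨⟨S, hS⟩, ⟨x, hx⟩, hirr⟩ := hV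
  refine ⟨fun h => ?_, fun {p q} hpq => ?_⟩
  · have h1 : (1 : MvPolynomial ι K) ∈ vanishingIdeal K V := by rw [h]; trivial
    have := h1 x hx
    simp at this
  · have hz : ∀ r : MvPolynomial ι K, IsZeroLocus K {x ∈ V | MvPolynomial.eval x r = 0} := by
      intro r
      refine ⟨insert r S, ?_⟩
      ext y
      simp only [hS, Set.mem_ofPred_eq, Set.mem_insert_iff, forall_eq_or_imp]
      tauto
    have hunion : V = {x ∈ V | MvPolynomial.eval x p = 0} ∪ {x ∈ V | MvPolynomial.eval x q = 0} := by
      ext y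
      constructor
      · intro hy
        have := hpq y hy
        rw [map_mul, mul_eq_zero] at this
        exact this.imp (fun h => ⟨hy, h⟩) (fun h => ⟨hy, h⟩)
      · rintro (h | h) <;> exact h.1
    refine (hirr _ _ (hz p) (hz q) hunion).imp (fun h y hy => ?_) (fun h y hy => ?_)
    · rw [h] at hy; exact hy.2
    · rw [h] at hy; exact hy.2

theorem aux_galois_indep {F K : Type} [Field F] [Field K] [Algebra F K] [IsGalois F K]
    {κ : Type} (β : κ → K) (hβ : LinearIndependent F β) (S : Finset κ) (y : κ → K)
    (h : ∀ τ : K ≃ₐ[F] K, ∑ i ∈ S, τ (β i) * y i = 0) : ∀ i ∈ S, y i = 0 := by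
  classical
  have h1 : LinearIndependent (FixedPoints.subfield (K ≃ₐ[F] K) K) β := by
    let i₀ : F →+* FixedPoints.subfield (K ≃ₐ[F] K) K :=
      (algebraMap F K).codRestrict _ (fun a τ => τ.commutes a)
    refine hβ.map_of_surjective_injective (i₀ : ZeroHom F _) (AddMonoidHom.id K) ?_ ?_ ?_
    · rintro ⟨a, ha⟩
      obtain ⟨b, hb⟩ := (InfiniteGalois.mem_range_algebraMap_iff_fixed (k := F) a).2 (fun τ => ha τ)
      exact ⟨b, Subtype.ext hb⟩
    · intro m hm; exact hm
    · intro r m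
      change r • m = (i₀ r) • m
      rw [Algebra.smul_def]; rfl
  have h2 : LinearIndepOn (FixedPoints.subfield (K ≃ₐ[F] K) K) id ((S.image β : Finset K) : Set K) := by
    have := h1.linearIndepOn_id
    exact this.mono (by simp)
  have h3 := FixedPoints.linearIndependent_smul_of_linearIndependent (K ≃ₐ[F] K) K h2
  have hinj : Function.Injective β := hβ.injective
  rw [linearIndepOn_finset_iff] at h3
  let z : K → K := fun b => ∑ i ∈ S, if β i = b then y i else 0
  have hz : ∀ i ∈ S, z (β i) = y i := by
    intro i hi
    simp only [z]
    rw [Finset.sum_eq_single i]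
    · simp
    · intro j _ hj; rw [if_neg (fun h => hj (hinj h))]
    · intro h; exact absurd hi h
  have h4 := h3 z (by
    ext τ
    rw [Finset.sum_image (fun a _ b _ h => hinj h)]
    simp only [Finset.sum_apply, Pi.smul_apply, smul_eq_mul, Pi.zero_apply, MulAction.toFun_apply]
    rw [← h τ]
    refine Finset.sum_congr rfl fun i hi => ?_
    rw [hz i hi, mul_comm]; rfl)
  intro i hi
  rw [← hz i hi]
  exact h4 _ (Finset.mem_image_of_mem β hi)

theorem aux_descent {F K σ : Type} [Field F] [Field K] [Algebra F K] [IsGalois F K]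
    (V : Set (σ → K)) (hVF : IsZeroLocusOver F K V) (p : MvPolynomial σ K)
    (hp : p ∈ vanishingIdeal K V) :
    p ∈ Submodule.span K ((MvPolynomial.map (algebraMap F K)) ''
      {q : MvPolynomial σ F | ∀ x ∈ V, MvPolynomial.aeval x q = 0}) := by
  classical
  let β := Module.Basis.ofVectorSpace F K
  let S := p.support.biUnion fun m => (β.repr (p.coeff m)).support
  let f : _ → MvPolynomial σ F := fun i =>
    ∑ m ∈ p.support, MvPolynomial.monomial m (β.repr (p.coeff m) i)
  have hpf : p = ∑ i ∈ S, β i • MvPolynomial.map (algebraMap F K) (f i) := by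
    conv_lhs => rw [MvPolynomial.as_sum p]
    simp only [f, map_sum, Finset.smul_sum, MvPolynomial.map_monomial, MvPolynomial.smul_monomial]
    rw [Finset.sum_comm]
    refine Finset.sum_congr rfl fun m hm => ?_
    rw [← map_sum]
    congr 1
    conv_lhs => rw [← β.linearCombination_repr (p.coeff m), Finsupp.linearCombination_apply]
    rw [Finsupp.sum_of_support_subset _ (s := S)]
    · refine Finset.sum_congr rfl fun i _ => ?_
      rw [Algebra.smul_def, smul_eq_mul, mul_comm]
    · exact Finset.subset_biUnion_of_mem (fun m => (β.repr (p.coeff m)).support) hm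
    · simp
  have hVτ : ∀ τ : K ≃ₐ[F] K, ∀ x ∈ V, (fun s => τ (x s)) ∈ V := by
    obtain ⟨s, hs⟩ := hVF
    intro τ x hx
    rw [hs] at hx ⊢
    intro q hq
    have := hx q hq
    have h2 : MvPolynomial.aeval (fun s => τ (x s)) q = τ (MvPolynomial.aeval x q) := by
      exact (MvPolynomial.comp_aeval_apply x (τ : K →ₐ[F] K) q).symm
    rw [h2, this, map_zero]
  have hf : ∀ i ∈ S, ∀ x ∈ V, MvPolynomial.aeval x (f i) = 0 := by
    intro i hi x hx
    refine aux_galois_indep β β.linearIndependent S (fun i => MvPolynomial.aeval x (f i)) ?_ i hi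
    intro τ
    have h1 := hp _ (hVτ τ.symm x hx)
    rw [hpf] at h1
    have h2 := congrArg τ h1
    simp only [map_sum, MvPolynomial.smul_eval, map_mul, map_zero] at h2
    rw [← h2]
    refine Finset.sum_congr rfl fun i _ => ?_
    congr 1
    rw [MvPolynomial.eval_map, ← MvPolynomial.aeval_def]
    have := MvPolynomial.comp_aeval_apply (fun s => τ.symm (x s)) (τ : K →ₐ[F] K) (f i)
    simp at this
    exact this.symm
  rw [hpf]
  refine Submodule.sum_mem _ fun i hi => Submodule.smul_mem _ _ (Submodule.subset_span ?_)
  exact ⟨f i, fun x hx => hf i hi x hx, rfl⟩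

theorem aux_select {K M : Type} [Field K] [AddCommGroup M] [Module K M] [Module.Finite K M]
    (s : Set M) (c : ℕ) (hc : Module.finrank K (Submodule.span K s) = c) :
    ∃ f : Fin c → M, (∀ i, f i ∈ s) ∧ Submodule.span K (Set.range f) = Submodule.span K s ∧
      LinearIndependent K f := by
  subst hc
  exact Submodule.exists_fun_fin_finrank_span_eq K s

theorem aux_minor {K σ : Type} [Field K] [Fintype σ] {c : ℕ} (A : Matrix (Fin c) σ K)
    (hA : LinearIndependent K A.row) :
    ∃ J : Fin c → σ, (Matrix.of fun i j => A i (J j)).det ≠ 0 := by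
  classical
  have hr : A.rank = c := by simpa using hA.rank_matrix
  rw [Matrix.rank_eq_finrank_span_cols] at hr
  obtain ⟨f, hf, _, hli⟩ := aux_select _ c hr
  choose J hJ using hf
  refine ⟨J, ?_⟩
  have : LinearIndependent K (Matrix.of fun i j => A i (J j)).col := by
    have h' : (Matrix.of fun i j => A i (J j)).col = f := by
      ext j i
      rw [← hJ]; rfl
    rw [h']
    exact hli
  rw [Matrix.linearIndependent_cols_iff_isUnit, Matrix.isUnit_iff_isUnit_det] at this
  exact this.ne_zero

theorem aux_data {F K σ : Type} [Field F] [Field K] [PerfectField K] [Algebra F K] [IsGalois F K]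
    [Fintype σ] (V : Set (σ → K)) (hV : IsIrredVariety K V) (hVF : IsZeroLocusOver F K V)
    (x₀ : σ → F) (hx₀ : IsNonsingularPoint K V (fun s => algebraMap F K (x₀ s)))
    (c : ℕ) (hc : varDim K V + (c : WithBot (WithTop ℕ))
      = ((Fintype.card σ : ℕ) : WithBot (WithTop ℕ))) :
    ∃ (P : Ideal (MvPolynomial σ F)) (g : Fin c → MvPolynomial σ F) (J : Fin c → σ),
      (∀ p, p ∈ P ↔ ∀ x ∈ V, MvPolynomial.aeval x p = 0) ∧
      (∀ p ∈ P, ∃ a : Fin c → MvPolynomial σ F, ∀ s,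
        (Matrix.of fun i j => MvPolynomial.pderiv (J j) (g i)).det * MvPolynomial.pderiv s p
          - ∑ i, a i * MvPolynomial.pderiv s (g i) ∈ P) ∧
      MvPolynomial.eval x₀ (Matrix.of fun i j => MvPolynomial.pderiv (J j) (g i)).det ≠ 0 := by
  classical
  have hprime := aux_prime V hV
  let ψ : MvPolynomial σ F →+* MvPolynomial σ K := MvPolynomial.map (algebraMap F K)
  let P : Ideal (MvPolynomial σ F) := (vanishingIdeal K V).comap ψ
  have heval : ∀ (x : σ → K) (p : MvPolynomial σ F),
      MvPolynomial.eval x (ψ p) = MvPolynomial.aeval x p := by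
    intro x p
    rw [MvPolynomial.eval_map, ← MvPolynomial.aeval_def]
  have hP : ∀ p, p ∈ P ↔ ∀ x ∈ V, MvPolynomial.aeval x p = 0 := by
    intro p
    change (∀ x ∈ V, MvPolynomial.eval x (ψ p) = 0) ↔ _
    simp only [heval]
  let y : σ → K := fun s => algebraMap F K (x₀ s)
  let dd : MvPolynomial σ K →ₗ[K] (σ → K) :=
    { toFun := fun p s => MvPolynomial.eval y (MvPolynomial.pderiv s p)
      map_add' := fun p q => by ext s; simp
      map_smul' := fun r p => by ext s; simp }
  have hdd : ∀ p s, dd p s = MvPolynomial.eval y (MvPolynomial.pderiv s p) := fun _ _ => rfl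
  let Z : Set (MvPolynomial σ F) := {q | ∀ x ∈ V, MvPolynomial.aeval x q = 0}
  let U : Set (σ → K) := dd '' (ψ '' Z)
  have hU : ∀ p ∈ vanishingIdeal K V, dd p ∈ Submodule.span K U := by
    intro p hp
    have := aux_descent V hVF p hp
    rw [← Submodule.map_span]
    exact Submodule.mem_map_of_mem this
  obtain ⟨f, hfU, hfspan, hfli⟩ := aux_select (K := K) U _ rfl
  have htan : tangentSpace K V y = LinearMap.ker (Matrix.of f).mulVecLin := by
    ext v
    rw [LinearMap.mem_ker]
    constructor
    · intro hv
      ext i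
      obtain ⟨_, ⟨q, hq, rfl⟩, hi⟩ := hfU i
      have := hv (ψ q) (by intro x hx; rw [heval]; exact hq x hx)
      simp only [Matrix.mulVecLin_apply, Matrix.mulVec, dotProduct, Matrix.of_apply, ← hi]
      exact this
    · intro hv p hp
      have h1 := hU p hp
      rw [← hfspan, Submodule.mem_span_range_iff_exists_fun] at h1
      obtain ⟨b, hb⟩ := h1
      have h2 : ∀ i, ∑ s, f i s * v s = 0 := fun i => congrFun hv i
      change ∑ s, dd p s * v s = 0
      rw [← hb]
      simp only [Finset.sum_apply, Pi.smul_apply, smul_eq_mul, Finset.sum_mul]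
      rw [Finset.sum_comm]
      refine Finset.sum_eq_zero fun i _ => ?_
      simp only [mul_assoc]
      rw [← Finset.mul_sum, h2, mul_zero]
  have hrank : Module.finrank K (Submodule.span K U) = c := by
    have h1 := (Matrix.of f).mulVecLin.finrank_range_add_finrank_ker
    have h2 : (Matrix.of f).rank = Module.finrank K (Submodule.span K U) := by
      have : LinearIndependent K (Matrix.of f).row := hfli
      simpa using this.rank_matrix
    rw [Matrix.rank] at h2
    rw [h2, ← htan, Module.finrank_fintype_fun_eq_card] at h1
    have h3 := hx₀.2
    change ((Module.finrank K ↥(tangentSpace K V y) : ℕ) : WithBot (WithTop ℕ)) = varDim K V at h3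
    rw [← h3] at hc
    have h4 : Module.finrank K ↥(tangentSpace K V y) + c = Fintype.card σ := by exact_mod_cast hc
    omega
  obtain ⟨f, hfU, -, hfli⟩ := aux_select U c hrank
  have hg : ∀ i, ∃ q : MvPolynomial σ F, q ∈ Z ∧ dd (ψ q) = f i := by
    intro i
    obtain ⟨_, ⟨q, hq, rfl⟩, hi⟩ := hfU i
    exact ⟨q, hq, hi⟩
  choose g hgZ hgf using hg
  obtain ⟨J, hJ⟩ := aux_minor (Matrix.of f) hfli
  let M : Matrix (Fin c) (Fin c) (MvPolynomial σ F) :=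
    Matrix.of fun i j => MvPolynomial.pderiv (J j) (g i)
  have hMdet : MvPolynomial.eval y (ψ M.det) ≠ 0 := by
    rw [RingHom.map_det, RingHom.map_det]
    convert hJ using 2
    ext i j
    simp only [RingHom.mapMatrix_apply, Matrix.map_apply, M, Matrix.of_apply, ← hgf, hdd]
    rw [MvPolynomial.pderiv_map]
  refine ⟨P, g, J, hP, ?_, ?_⟩
  · intro p hp
    refine ⟨fun i => ∑ j, MvPolynomial.pderiv (J j) p * M.adjugate j i, fun s => ?_⟩
    have h := aux_generic_s2 (vanishingIdeal K V) c hc (fun i => ψ (g i)) (fun i => (hP _).2 (hgZ i)) J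
      (ψ.mapMatrix M) (by
        ext1 i j
        simp only [RingHom.mapMatrix_apply, Matrix.map_apply, M, Matrix.of_apply]
        rw [MvPolynomial.pderiv_map]) (by
        rw [← RingHom.map_det]
        exact fun h => hMdet (h y hx₀.1)) (ψ p) hp s
    change ψ _ ∈ vanishingIdeal K V
    convert h using 1
    rw [← RingHom.map_adjugate, ← RingHom.map_det]
    simp only [map_sub, map_mul, map_sum, RingHom.mapMatrix_apply, Matrix.map_apply, ψ,
      MvPolynomial.pderiv_map, M]
  · intro h
    apply hMdet
    rw [heval]
    have : MvPolynomial.aeval y M.det = algebraMap F K (MvPolynomial.eval x₀ M.det) := by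
      have h2 := MvPolynomial.aeval_algebraMap_apply K x₀ M.det
      rw [MvPolynomial.aeval_eq_eval] at h2
      exact h2
    rw [this]
    change algebraMap F K (MvPolynomial.eval x₀ M.det) = 0
    rw [h, map_zero]

/-- **Theorem (partition-rank bound over a perfect field)**: let `T` be a tensor of
order `k+1 ≥ 2` over a perfect field `𝔽`, with slicing `T̃` along the last axis,
and let `X ⊆ ker T̃` (inside `𝔽̄^N`, `𝔽̄` the algebraic closure) be an irreducible
variety defined over `𝔽` possessing an `𝔽`-rational point `x₀` that is neither
singular nor `DT̃`-singular (the Jacobian of `T̃` has maximal rank on `X` at `x₀`).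
Then `PR(T) ≤ (2^k − 1)·codim X`, where `codim X = c` is encoded by
`dim X + c = N`. -/
theorem statement2 (k : ℕ) (hk : 1 ≤ k) (𝔽 : Type) [Field 𝔽] [PerfectField 𝔽]
    (d : Fin (k+1) → ℕ) (T : ((i : Fin (k+1)) → Fin (d i)) → 𝔽)
    (X : Set (((i : Fin k) × Fin (d i.castSucc)) → AlgebraicClosure 𝔽))
    (hXirr : IsIrredVariety (AlgebraicClosure 𝔽) X)
    (hXF : IsZeroLocusOver 𝔽 (AlgebraicClosure 𝔽) X)
    (hXker : ∀ x ∈ X, ∀ j : Fin (d (Fin.last k)),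
      MvPolynomial.aeval x (sliceP T j) = 0)
    (x₀ : ((i : Fin k) × Fin (d i.castSucc)) → AlgebraicClosure 𝔽)
    (hx₀rat : ∀ s, x₀ s ∈ Set.range (algebraMap 𝔽 (AlgebraicClosure 𝔽)))
    (hx₀ns : IsNonsingularPoint (AlgebraicClosure 𝔽) X x₀)
    (hx₀DT : ∀ x ∈ X,
      (Matrix.of fun (j : Fin (d (Fin.last k))) (s : (i : Fin k) × Fin (d i.castSucc)) =>
        MvPolynomial.aeval x (MvPolynomial.pderiv s (sliceP T j))).rank ≤
      (Matrix.of fun (j : Fin (d (Fin.last k))) (s : (i : Fin k) × Fin (d i.castSucc)) =>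
        MvPolynomial.aeval x₀ (MvPolynomial.pderiv s (sliceP T j))).rank)
    (c : ℕ)
    (hc : varDim (AlgebraicClosure 𝔽) X + (c : WithBot (WithTop ℕ))
      = ((Fintype.card ((i : Fin k) × Fin (d i.castSucc)) : ℕ) : WithBot (WithTop ℕ))) :
    partitionRank T ≤ (2 ^ k - 1) * c := by
  classical
  choose x₁ hx₁ using hx₀rat
  obtain rfl : (fun s => algebraMap 𝔽 (AlgebraicClosure 𝔽) (x₁ s)) = x₀ := funext hx₁
  have hgal : IsGalois 𝔽 (AlgebraicClosure 𝔽) := {}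
  obtain ⟨P, g, J, hP, hstar, hΔ⟩ := aux_data X hXirr hXF x₁ hx₀ns c hc
  let N : Ideal (MvPolynomial ((i : Fin k) × Fin (d i.castSucc)) 𝔽) :=
    Ideal.span {q | ∃ s s', s.1 = s'.1 ∧ q = MvPolynomial.X s * MvPolynomial.X s'}
  obtain ⟨a, ha, haP⟩ := aux_jets_s2 (A := MvPolynomial ((i : Fin k) × Fin (d i.castSucc)) 𝔽 ⧸ N)
    P g J hstar x₁ (by
      intro p hp
      have h1 := (hP p).1 hp _ hx₀ns.1
      have h2 := MvPolynomial.aeval_algebraMap_apply (AlgebraicClosure 𝔽) x₁ p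
      have h3 : algebraMap 𝔽 (AlgebraicClosure 𝔽) (MvPolynomial.aeval x₁ p) = 0 := by
        rw [← h2]; exact h1
      rw [map_eq_zero] at h3
      simpa [MvPolynomial.aeval_eq_eval] using h3) hΔ
    (fun s => Ideal.Quotient.mk N (MvPolynomial.X s)) (by
      intro s s' h
      rw [← map_mul, Ideal.Quotient.eq_zero_iff_mem]
      exact Ideal.subset_span ⟨s, s', h, rfl⟩)
  choose b hb using fun j => Ideal.Quotient.mk_surjective (a j)
  have hN0 : ∀ q ∈ N, MvPolynomial.constantCoeff q = 0 := by
    intro q hq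
    have : N ≤ RingHom.ker (MvPolynomial.constantCoeff
        (R := 𝔽) (σ := (i : Fin k) × Fin (d i.castSucc))) := by
      rw [Ideal.span_le]
      rintro _ ⟨s, s', _, rfl⟩
      simp
    exact this hq
  let e := Ideal.Quotient.lift N MvPolynomial.constantCoeff hN0
  refine aux_pr T x₁ b ?_ J ?_
  · intro j
    have h1 : Ideal.span (Set.range fun s : (i : Fin k) × Fin (d i.castSucc) =>
        Ideal.Quotient.mk N (MvPolynomial.X s)) ≤ RingHom.ker e := by
      rw [Ideal.span_le]
      rintro _ ⟨s, rfl⟩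
      change e (Ideal.Quotient.mk N (MvPolynomial.X s)) = 0
      simp [e]
    have h2 : e (a j) = 0 := h1 (ha j)
    rw [← hb j] at h2
    exact h2
  · intro j
    have hj : sliceP T j ∈ P := (hP _).2 fun x hx => hXker x hx j
    have h1 := haP _ hj
    change _ ∈ N
    rw [← Ideal.Quotient.eq_zero_iff_mem, ← h1]
    have h2 := MvPolynomial.comp_aeval_apply (fun s => MvPolynomial.C (x₁ s) + MvPolynomial.X s
      + (∑ l, Pi.single (J l) (b l) : ((i : Fin k) × Fin (d i.castSucc)) →
        MvPolynomial ((i : Fin k) × Fin (d i.castSucc)) 𝔽) s)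
      (Ideal.Quotient.mkₐ 𝔽 N) (sliceP T j)
    refine h2.trans ?_
    congr 2
    ext s
    simp only [map_add, Finset.sum_apply, map_sum, Ideal.Quotient.mkₐ_eq_mk]
    congr 1
    refine Finset.sum_congr rfl fun l _ => ?_
    by_cases h : s = J l
    · subst h; simp [hb]
    · simp [h]
end
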